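/- Let p ∈ (0,∞) and n ≥ 1. For every φ ∈ Cvx(ℝⁿ), inf_{x∈ℝⁿ} M_p(T_x φ) ≤ (2π·√((1+p)^{(1+p)/p}/p))ⁿ, i.e. the infimum over translations of the L^p-Mahler integral of φ is at most the L^p-Mahler integral of the convex quadratic x ↦ |x|²/2. -/

import Mathlib

open MeasureTheory Real Filter
open scoped ENNReal RealInnerProductSpace Classical

noncomputable section

abbrev Euc (n : ℕ) : Type := EuclideanSpace ℝ (Fin n)

/-- `e^t` as an extended nonnegative real, for `t : EReal` (`e^{-∞}=0`, `e^{+∞}=∞`). -/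
def erealExp (t : EReal) : ℝ≥0∞ :=
  if t = ⊥ then 0 else if t = ⊤ then ⊤ else ENNReal.ofReal (Real.exp t.toReal)

/-- The volume `V(f) = ∫ e^{-f}` of `f : ℝⁿ → ℝ ∪ {+∞}`, as an extended nonnegative real. -/
def VolE {n : ℕ} (f : Euc n → EReal) : ℝ≥0∞ := ∫⁻ x, erealExp (-(f x))

/-- The volume `V(f) = ∫ e^{-f}` as a real number. -/
def Vol {n : ℕ} (f : Euc n → EReal) : ℝ := (VolE f).toReal

/-- `∫ e^{p⟨x,y⟩ - (p+1) f(x)} dx`. -/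
def LpIntE {n : ℕ} (p : ℝ) (f : Euc n → EReal) (y : Euc n) : ℝ≥0∞ :=
  ∫⁻ x, erealExp (((p * ⟪x, y⟫ : ℝ) : EReal) - ((p + 1 : ℝ) : EReal) * f x)

/-- The `L^p`-Legendre transform
`f^{*,p}(y) = (1/p) log ( ∫ e^{p⟨x,y⟩ - (p+1) f(x)} dx / V(f) )`,
with value `+∞` when the integral diverges. -/
def LpStar {n : ℕ} (p : ℝ) (f : Euc n → EReal) (y : Euc n) : EReal :=
  if LpIntE p f y = ⊤ then ⊤
  else (((1 / p) * Real.log ((LpIntE p f y).toReal / Vol f) : ℝ) : EReal)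

/-- The `L^p`-Mahler integral `M_p(f) = V(f) · V(f^{*,p})`, as an extended nonnegative real. -/
def MpE {n : ℕ} (p : ℝ) (f : Euc n → EReal) : ℝ≥0∞ := VolE f * VolE (LpStar p f)

/-- The translate `(T_a f)(x) = f(x + a)`. -/
def Transl {n : ℕ} (a : Euc n) (f : Euc n → EReal) : Euc n → EReal := fun x => f (x + a)

/-- Convexity of an `ℝ ∪ {+∞}`-valued function. -/
def ConvexE {n : ℕ} (φ : Euc n → EReal) : Prop :=
  ∀ x y : Euc n, ∀ l : ℝ, 0 ≤ l → l ≤ 1 →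
    φ ((1 - l) • x + l • y) ≤ ((1 - l : ℝ) : EReal) * φ x + ((l : ℝ) : EReal) * φ y

/-- The class `Cvx(ℝⁿ)`: convex, lower semicontinuous functions `ℝⁿ → ℝ ∪ {+∞}`,
not identically `+∞`, with `0 < V(φ) < ∞`. -/
structure InCvx {n : ℕ} (φ : Euc n → EReal) : Prop where
  noBot : ∀ x, φ x ≠ ⊥
  convex : ConvexE φ
  lsc : LowerSemicontinuous φ
  proper : ∃ x, φ x ≠ ⊤
  volPos : 0 < VolE φ
  volFin : VolE φ < ⊤

/-- The barycenter `b(g) = ∫ x e^{-g(x)} dx / V(g)`. -/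
def bary {n : ℕ} (g : Euc n → EReal) : Euc n :=
  (Vol g)⁻¹ • ∫ x, (erealExp (-(g x))).toReal • x

/-- The classical Legendre transform `f^*(y) = sup_x (⟨x,y⟩ - f(x))`. -/
def Lstar {n : ℕ} (f : Euc n → EReal) (y : Euc n) : EReal :=
  ⨆ x : Euc n, (((⟪x, y⟫ : ℝ) : EReal) - f x)



section

/-- One dimensional Brunn-Minkowski (midpoint form). -/
theorem bm_one {A B C : Set ℝ} (hA : MeasurableSet A) (hB : MeasurableSet B) (hC : MeasurableSet C)
    (nA : A.Nonempty) (nB : B.Nonempty) (h : ∀ a ∈ A, ∀ b ∈ B, (a + b) / 2 ∈ C) :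
    volume A + volume B ≤ 2 * volume C := by
  set D : Set ℝ := (fun x : ℝ => (2⁻¹ : ℝ) • x) ⁻¹' C with hD
  have hDm : MeasurableSet D := (measurable_const_smul _) hC
  have hDv : volume D = 2 * volume C := by
    rw [hD, Measure.addHaar_preimage_smul _ (by norm_num : (2⁻¹ : ℝ) ≠ 0)]
    simp
  have key : ∀ K ⊆ A, IsCompact K → ∀ K' ⊆ B, IsCompact K' → volume K + volume K' ≤ volume D := by
    have key1 : ∀ K ⊆ A, IsCompact K → K.Nonempty → ∀ K' ⊆ B, IsCompact K' → K'.Nonempty →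
        volume K + volume K' ≤ volume D := by
      intro K hK cK nK K' hK' cK' nK'
      obtain ⟨M, hM⟩ := cK.exists_isGreatest nK
      obtain ⟨m, hm⟩ := cK'.exists_isLeast nK'
      have h1 : volume K ≤ volume (D ∩ Set.Iio (M + m)) := by
        have e1 : volume (D ∩ Set.Iio (M + m)) = volume (D ∩ Set.Iic (M + m)) := by
          apply measure_congr
          exact (ae_eq_refl D).inter Iio_ae_eq_Iic
        rw [e1, ← measure_preimage_add_right volume m (D ∩ Set.Iic (M + m))]
        apply measure_mono
        intro x hx
        refine ⟨?_, ?_⟩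
        · show (2⁻¹ : ℝ) • (x + m) ∈ C
          have := h x (hK hx) m (hK' hm.1)
          convert this using 1
          simp; ring
        · have := hM.2 hx
          simp; exact this
      have h2 : volume K' ≤ volume (D ∩ Set.Ici (M + m)) := by
        rw [← measure_preimage_add volume M (D ∩ Set.Ici (M + m))]
        apply measure_mono
        intro x hx
        refine ⟨?_, ?_⟩
        · show (2⁻¹ : ℝ) • (M + x) ∈ C
          have := h M (hK hM.1) x (hK' hx)
          convert this using 1
          simp; ring
        · have := hm.2 hx
          simp; exact this
      calc volume K + volume K' ≤ volume (D ∩ Set.Iio (M + m)) + volume (D ∩ Set.Ici (M + m)) :=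
            add_le_add h1 h2
        _ = volume D := by
            rw [← Set.compl_Iio, ← Set.sdiff_eq]
            exact measure_inter_add_sdiff D measurableSet_Iio
    intro K hK cK K' hK' cK'
    obtain ⟨a, ha⟩ := nA
    obtain ⟨b, hb⟩ := nB
    refine le_trans (add_le_add (measure_mono (Set.subset_insert a K))
      (measure_mono (Set.subset_insert b K'))) ?_
    exact key1 _ (Set.insert_subset ha hK) (cK.insert a) ⟨a, by simp⟩ _ (Set.insert_subset hb hK')
      (cK'.insert b) ⟨b, by simp⟩
  rw [← hDv, hA.measure_eq_iSup_isCompact, hB.measure_eq_iSup_isCompact]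
  simp only [iSup_and']
  refine ENNReal.biSup_add_biSup_le' ⟨∅, by simp⟩ ⟨∅, by simp⟩ ?_
  intro K hK K' hK'
  exact key K hK.1 hK.2 K' hK'.1 hK'.2

theorem pl_norm {f g h : ℝ → ℝ} (hf : Measurable f) (hg : Measurable g) (hh : Measurable h)
    (f0 : ∀ x, 0 ≤ f x) (g0 : ∀ x, 0 ≤ g x) (h0 : ∀ x, 0 ≤ h x)
    (f1 : ∀ x, f x ≤ 1) (g1 : ∀ x, g x ≤ 1)
    (fs : ∀ s < 1, ∃ x, s < f x) (gs : ∀ s < 1, ∃ x, s < g x)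
    (H : ∀ x y, f x * g y ≤ h ((x + y) / 2) ^ 2) :
    (∫⁻ x, ENNReal.ofReal (f x)) + ∫⁻ x, ENNReal.ofReal (g x) ≤ 2 * ∫⁻ x, ENNReal.ofReal (h x) := by
  rw [lintegral_eq_lintegral_meas_lt _ (ae_of_all _ f0) hf.aemeasurable,
    lintegral_eq_lintegral_meas_lt _ (ae_of_all _ g0) hg.aemeasurable,
    lintegral_eq_lintegral_meas_lt _ (ae_of_all _ h0) hh.aemeasurable]
  have anti : Antitone (fun t => volume {a | t < f a}) := fun s t hst =>
    measure_mono (fun x hx => lt_of_le_of_lt hst hx)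
  have anti2 : Antitone (fun t => volume {a | t < h a}) := fun s t hst =>
    measure_mono (fun x hx => lt_of_le_of_lt hst hx)
  rw [← lintegral_add_left anti.measurable, ← lintegral_const_mul _ anti2.measurable]
  apply setLIntegral_mono (anti2.measurable.const_mul _)
  intro t ht
  have ht : 0 < t := ht
  by_cases h1 : t < 1
  · apply bm_one (measurableSet_lt measurable_const hf) (measurableSet_lt measurable_const hg)
      (measurableSet_lt measurable_const hh) (fs t h1) (gs t h1)
    intro a ha b hb
    have ha : t < f a := ha
    have hb : t < g b := hb
    show t < h ((a + b) / 2)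
    have h2 := H a b
    have h3 : t * t < f a * g b := mul_lt_mul'' ha hb ht.le ht.le
    nlinarith [h0 ((a + b) / 2)]
  · have e1 : {a | t < f a} = ∅ := by
      ext x; simp; linarith [f1 x]
    have e2 : {a | t < g a} = ∅ := by
      ext x; simp; linarith [g1 x]
    simp [e1, e2]

theorem ennreal_amgm {X Y Z : ℝ≥0∞} (h : X + Y ≤ 2 * Z) : X * Y ≤ Z ^ 2 := by
  by_cases hZ : Z = ⊤
  · simp [hZ]
  have hX : X ≠ ⊤ := by
    rintro rfl
    simp at h
    exact ENNReal.mul_ne_top (by simp) hZ h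
  have hY : Y ≠ ⊤ := by
    rintro rfl
    simp at h
    exact ENNReal.mul_ne_top (by simp) hZ h
  lift X to NNReal using hX
  lift Y to NNReal using hY
  lift Z to NNReal using hZ
  norm_cast at *
  have h' : (X : ℝ) + Y ≤ 2 * Z := by exact_mod_cast h
  have : (X : ℝ) * Y ≤ (Z : ℝ) ^ 2 := by
    have := X.2; have := Y.2; have := Z.2
    nlinarith [sq_nonneg ((X : ℝ) - Y), X.coe_nonneg, Y.coe_nonneg, Z.coe_nonneg]
  exact_mod_cast this

theorem pl_bdd {f g h : ℝ → ℝ≥0∞} (hf : Measurable f) (hg : Measurable g) (hh : Measurable h)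
    (fb : ⨆ x, f x ≠ ⊤) (gb : ⨆ x, g x ≠ ⊤)
    (H : ∀ x y, f x * g y ≤ h ((x + y) / 2) ^ 2) :
    (∫⁻ x, f x) * ∫⁻ x, g x ≤ (∫⁻ x, h x) ^ 2 := by
  set a := ⨆ x, f x with ha
  set b := ⨆ x, g x with hb
  have fa : ∀ x, f x ≤ a := fun x => le_iSup f x
  have gb' : ∀ x, g x ≤ b := fun x => le_iSup g x
  by_cases a0 : a = 0
  · have : ∀ x, f x = 0 := fun x => le_antisymm (a0 ▸ fa x) (by simp)
    simp [this]
  by_cases b0 : b = 0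
  · have : ∀ x, g x = 0 := fun x => le_antisymm (b0 ▸ gb' x) (by simp)
    simp [this]
  set c : ℝ≥0∞ := (a * b) ^ (1/2 : ℝ) with hc
  have cc : c ^ 2 = a * b := by
    rw [hc, ← ENNReal.rpow_natCast, ← ENNReal.rpow_mul]; norm_num
  have c0 : c ≠ 0 := by
    intro h; rw [h] at cc; simp at cc; tauto
  have ct : c ≠ ⊤ := by
    intro h; rw [h] at cc
    have := ENNReal.mul_ne_top fb gb
    exact this (by rw [← cc]; simp)
  set F : ℝ → ℝ := fun x => (f x / a).toReal
  set G : ℝ → ℝ := fun x => (g x / b).toReal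
  set K : ℝ → ℝ := fun x => (min (h x / c) 1).toReal
  have f1 : ∀ x, f x / a ≤ 1 := fun x => ENNReal.div_le_of_le_mul (by simpa using fa x)
  have g1 : ∀ x, g x / b ≤ 1 := fun x => ENNReal.div_le_of_le_mul (by simpa using gb' x)
  have ft : ∀ x, f x / a ≠ ⊤ := fun x => ne_top_of_le_ne_top ENNReal.one_ne_top (f1 x)
  have gt : ∀ x, g x / b ≠ ⊤ := fun x => ne_top_of_le_ne_top ENNReal.one_ne_top (g1 x)
  have kt : ∀ x, min (h x / c) 1 ≠ ⊤ := fun x => ne_top_of_le_ne_top ENNReal.one_ne_top (min_le_right _ _)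
  have sup1 : ∀ (f : ℝ → ℝ≥0∞) (a : ℝ≥0∞), a = ⨆ x, f x → a ≠ 0 → a ≠ ⊤ → (∀ x, f x / a ≠ ⊤) →
      ∀ s < (1:ℝ), ∃ x, s < (f x / a).toReal := by
    intro f a ha a0 at' ft s hs
    by_cases hs0 : s < 0
    · exact ⟨0, lt_of_lt_of_le hs0 ENNReal.toReal_nonneg⟩
    push Not at hs0
    have : ENNReal.ofReal s * a < a := by
      calc ENNReal.ofReal s * a < 1 * a := by
            apply ENNReal.mul_lt_mul_left a0 at'
            simpa using hs
        _ = a := one_mul a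
    conv at this => rhs; rw [ha]
    obtain ⟨x, hx⟩ := lt_iSup_iff.1 this
    refine ⟨x, ?_⟩
    rw [← ENNReal.ofReal_lt_iff_lt_toReal hs0 (ft x)]
    rwa [ENNReal.lt_div_iff_mul_lt (Or.inl a0) (Or.inl at')]
  have key := pl_norm (f := F) (g := G) (h := K) (hf.div_const a).ennreal_toReal
    (hg.div_const b).ennreal_toReal ((hh.div_const c).min measurable_const).ennreal_toReal
    (fun x => ENNReal.toReal_nonneg) (fun x => ENNReal.toReal_nonneg)
    (fun x => ENNReal.toReal_nonneg)
    (fun x => ENNReal.toReal_le_of_le_ofReal zero_le_one (by simpa using f1 x))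
    (fun x => ENNReal.toReal_le_of_le_ofReal zero_le_one (by simpa using g1 x))
    (sup1 f a ha a0 fb ft) (sup1 g b hb b0 gb gt) (by
      intro x y
      show (f x / a).toReal * (g y / b).toReal ≤ (min (h ((x + y) / 2) / c) 1).toReal ^ 2
      rw [← ENNReal.toReal_mul, ← ENNReal.toReal_pow]
      apply ENNReal.toReal_mono (ENNReal.pow_ne_top (kt _))
      rcases le_total (h ((x + y) / 2) / c) 1 with h1 | h1
      · rw [min_eq_left h1, div_eq_mul_inv, div_eq_mul_inv, div_eq_mul_inv, mul_pow,
          ← ENNReal.inv_pow, cc, ENNReal.mul_inv (Or.inl a0) (Or.inl fb)]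
        calc f x * a⁻¹ * (g y * b⁻¹) = (f x * g y) * (a⁻¹ * b⁻¹) := by ring
          _ ≤ _ := by gcongr; exact H x y
      · rw [min_eq_right h1, one_pow]
        exact mul_le_one' (f1 x) (g1 y))
  simp only [F, G, K] at key
  simp only [ENNReal.ofReal_toReal (ft _), ENNReal.ofReal_toReal (gt _),
    ENNReal.ofReal_toReal (kt _)] at key
  have key2 : (∫⁻ x, f x / a) + ∫⁻ x, g x / b ≤ 2 * ∫⁻ x, h x / c :=
    key.trans (by gcongr; exact min_le_left _ _)
  have key3 := ennreal_amgm key2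
  simp only [div_eq_mul_inv] at key3
  rw [lintegral_mul_const _ hf, lintegral_mul_const _ hg, lintegral_mul_const _ hh, mul_pow,
    ← ENNReal.inv_pow, cc, ENNReal.mul_inv (Or.inl a0) (Or.inl fb)] at key3
  have ab0 : a * b ≠ 0 := mul_ne_zero a0 b0
  have abt : a * b ≠ ⊤ := ENNReal.mul_ne_top fb gb
  calc (∫⁻ x, f x) * ∫⁻ x, g x
      = ((∫⁻ x, f x) * a⁻¹ * ((∫⁻ x, g x) * b⁻¹)) * (a * b) := by
        calc _ = (∫⁻ x, f x) * (∫⁻ x, g x) * ((a⁻¹ * a) * (b⁻¹ * b)) := by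
              rw [ENNReal.inv_mul_cancel a0 fb, ENNReal.inv_mul_cancel b0 gb]; simp
          _ = _ := by ring
    _ ≤ ((∫⁻ x, h x) ^ 2 * (a⁻¹ * b⁻¹)) * (a * b) := by gcongr
    _ = (∫⁻ x, h x) ^ 2 := by
        calc _ = (∫⁻ x, h x) ^ 2 * ((a⁻¹ * a) * (b⁻¹ * b)) := by ring
          _ = _ := by rw [ENNReal.inv_mul_cancel a0 fb, ENNReal.inv_mul_cancel b0 gb]; simp

theorem lint_trunc {α : Type*} [MeasurableSpace α] (μ : Measure α) {f : α → ℝ≥0∞}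
    (hf : Measurable f) : ∫⁻ x, f x ∂μ = ⨆ N : ℕ, ∫⁻ x, min (f x) (N : ℝ≥0∞) ∂μ := by
  rw [← lintegral_iSup (fun N => hf.min measurable_const)]
  · congr 1; ext x
    apply le_antisymm
    · apply le_of_forall_lt
      intro c hc
      obtain ⟨N, hN⟩ := ENNReal.exists_nat_gt (ne_top_of_lt hc)
      exact lt_of_lt_of_le (lt_min hc hN) (le_iSup (fun N : ℕ => min (f x) (N : ℝ≥0∞)) N)
    · exact iSup_le fun N => min_le_left _ _
  · intro N M h x
    dsimp
    gcongr

/-- Midpoint Prékopa-Leindler property of a measure space. -/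
def PLProp (X : Type*) [AddCommGroup X] [Module ℝ X] [MeasureSpace X] : Prop :=
  ∀ f g h : X → ℝ≥0∞, Measurable f → Measurable g → Measurable h →
    (∀ x y, f x * g y ≤ h ((2⁻¹ : ℝ) • (x + y)) ^ 2) →
    (∫⁻ x, f x) * ∫⁻ x, g x ≤ (∫⁻ x, h x) ^ 2

theorem pl_real : PLProp ℝ := by
  intro f g h hf hg hh H
  rw [lint_trunc _ hf, lint_trunc _ hg, ENNReal.iSup_mul]
  refine iSup_le fun N => ?_
  rw [ENNReal.mul_iSup]
  refine iSup_le fun M => ?_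
  apply pl_bdd (hf.min measurable_const) (hg.min measurable_const) hh
  · exact ne_top_of_le_ne_top (ENNReal.natCast_ne_top N) (iSup_le fun x => min_le_right _ _)
  · exact ne_top_of_le_ne_top (ENNReal.natCast_ne_top M) (iSup_le fun x => min_le_right _ _)
  · intro x y
    have := H x y
    have e : (2⁻¹ : ℝ) • (x + y) = (x + y) / 2 := by simp; ring
    rw [e] at this
    exact (mul_le_mul' (min_le_left _ _) (min_le_left _ _)).trans this

theorem pl_prod {X Y : Type*} [AddCommGroup X] [Module ℝ X] [MeasureSpace X]
    [AddCommGroup Y] [Module ℝ Y] [MeasureSpace Y] [SFinite (volume : Measure Y)]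
    [SFinite (volume : Measure X)]
    (hX : PLProp X) (hY : PLProp Y) : PLProp (X × Y) := by
  intro f g h hf hg hh H
  rw [Measure.volume_eq_prod, lintegral_prod _ hf.aemeasurable, lintegral_prod _ hg.aemeasurable,
    lintegral_prod _ hh.aemeasurable]
  apply hX _ _ _ hf.lintegral_prod_right' hg.lintegral_prod_right' hh.lintegral_prod_right'
  intro x x'
  apply hY _ _ _ (by fun_prop) (by fun_prop) (by fun_prop)
  intro y y'
  exact H (x, y) (x', y')

theorem pl_equiv {X Y : Type*} [AddCommGroup X] [Module ℝ X] [MeasureSpace X]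
    [AddCommGroup Y] [Module ℝ Y] [MeasureSpace Y] (e : X → Y) (he : MeasurePreserving e)
    (hadd : ∀ x y, e ((2⁻¹ : ℝ) • (x + y)) = (2⁻¹ : ℝ) • (e x + e y)) (hX : PLProp X) :
    PLProp Y := by
  intro f g h hf hg hh H
  rw [← he.lintegral_comp hf, ← he.lintegral_comp hg, ← he.lintegral_comp hh]
  apply hX _ _ _ (hf.comp he.measurable) (hg.comp he.measurable) (hh.comp he.measurable)
  intro x y
  simp only [Function.comp]
  rw [hadd]
  exact H _ _

theorem pl_pi (n : ℕ) : PLProp (Fin n → ℝ) := by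
  induction n with
  | zero =>
    intro f g h hf hg hh H
    have e : (volume : Measure (Fin 0 → ℝ)) = Measure.dirac (fun _ => 0) := by
      rw [volume_pi]
      exact Measure.pi_of_empty _ _
    rw [e, lintegral_dirac' _ hf, lintegral_dirac' _ hg, lintegral_dirac' _ hh]
    convert H _ _ using 3
  | succ n ih =>
    refine pl_equiv _ (volume_preserving_piFinSuccAbove (fun _ : Fin (n + 1) => ℝ) 0).symm ?_
      (pl_prod pl_real ih)
    intro x y
    ext i
    refine Fin.cases ?_ ?_ i
    · simp [MeasurableEquiv.piFinSuccAbove]; ring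
    · intro j
      simp [MeasurableEquiv.piFinSuccAbove]; ring

theorem pl_euc (n : ℕ) : PLProp (Euc n) :=
  pl_equiv _ (PiLp.volume_preserving_toLp (Fin n)) (fun _ _ => rfl) (pl_pi n)

end

section

/-- shorthand: real exponential as extended nonnegative real -/
def eexp (t : ℝ) : ℝ≥0∞ := ENNReal.ofReal (Real.exp t)

theorem eexp_add (s t : ℝ) : eexp (s + t) = eexp s * eexp t := by
  unfold eexp
  rw [Real.exp_add, ENNReal.ofReal_mul (Real.exp_pos _).le]

theorem eexp_ne_top (s : ℝ) : eexp s ≠ ⊤ := ENNReal.ofReal_ne_top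
theorem eexp_ne_zero (s : ℝ) : eexp s ≠ 0 := by
  unfold eexp
  exact (ENNReal.ofReal_pos.2 (Real.exp_pos _)).ne'
theorem eexp_pos (s : ℝ) : 0 < eexp s := pos_iff_ne_zero.2 (eexp_ne_zero s)

theorem eexp_mono {s t : ℝ} (h : s ≤ t) : eexp s ≤ eexp t :=
  ENNReal.ofReal_le_ofReal (Real.exp_le_exp.2 h)

theorem eexp_zero : eexp 0 = 1 := by simp [eexp]

theorem eexp_rpow (s r : ℝ) : eexp s ^ r = eexp (s * r) := by
  unfold eexp
  rw [ENNReal.ofReal_rpow_of_pos (Real.exp_pos _), Real.exp_mul]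

theorem eexp_sq (s : ℝ) : eexp s ^ 2 = eexp (2 * s) := by
  rw [sq, ← eexp_add]; congr 1; ring

theorem eexp_neg_mul (s : ℝ) : eexp (-s) * eexp s = 1 := by
  rw [← eexp_add]; simp [eexp_zero]

@[fun_prop]
theorem measurable_eexp : Measurable eexp :=
  ENNReal.measurable_ofReal.comp Real.measurable_exp

theorem continuous_eexp : Continuous eexp :=
  ENNReal.continuous_ofReal.comp Real.continuous_exp

variable {n : ℕ}

theorem lint_trans (f : Euc n → ℝ≥0∞) (a : Euc n) : ∫⁻ x, f (x + a) = ∫⁻ x, f x :=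
  lintegral_add_right_eq_self f a

theorem lint_neg (f : Euc n → ℝ≥0∞) : ∫⁻ x, f (-x) = ∫⁻ x, f x :=
  lintegral_neg_eq_self f

/-- linear change of variables -/
theorem lint_lin (L : Euc n →ₗ[ℝ] Euc n) (hL : LinearMap.det L ≠ 0) {f : Euc n → ℝ≥0∞}
    (hf : Measurable f) :
    ∫⁻ x, f (L x) = ENNReal.ofReal |(LinearMap.det L)⁻¹| * ∫⁻ x, f x := by
  have h := Measure.map_linearMap_addHaar_eq_smul_addHaar (volume : Measure (Euc n)) hL
  have h2 : ∫⁻ x, f x ∂(Measure.map L volume) = ∫⁻ x, f (L x) :=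
    lintegral_map hf (L.continuous_of_finiteDimensional.measurable)
  rw [← h2, h, lintegral_smul_measure]; rfl

theorem gauss_base (b : ℝ) (hb : 0 < b) :
    ∫⁻ x : Euc n, eexp (-(b * ‖x‖ ^ 2)) = ENNReal.ofReal ((π / b) ^ ((n : ℝ) / 2)) := by
  have h := GaussianFourier.integral_rexp_neg_mul_sq_norm (V := Euc n) hb
  have hi : Integrable (fun v : Euc n => rexp (-b * ‖v‖ ^ 2)) := by
    by_contra hc
    rw [integral_undef hc] at h
    have : 0 < (π / b) ^ (Module.finrank ℝ (Euc n) / 2 : ℝ) := by positivity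
    linarith
  have := ofReal_integral_eq_lintegral_ofReal hi (ae_of_all _ fun x => (Real.exp_pos _).le)
  rw [h] at this
  simp only [finrank_euclideanSpace, Fintype.card_fin] at this
  rw [this]
  simp [eexp]

theorem gauss_lint (b : ℝ) (hb : 0 < b) (w : Euc n) :
    ∫⁻ x : Euc n, eexp (⟪x, w⟫ - b * ‖x‖ ^ 2) =
      ENNReal.ofReal ((π / b) ^ ((n : ℝ) / 2)) * eexp (‖w‖ ^ 2 / (4 * b)) := by
  rw [← gauss_base b hb, ← lint_trans (fun x => eexp (-(b * ‖x‖ ^ 2))) (-((2 * b)⁻¹ • w)),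
    ← lintegral_mul_const]
  · apply lintegral_congr
    intro x
    rw [← eexp_add]
    congr 1
    have e : ‖x + -((2 * b)⁻¹ • w)‖ ^ 2 = ‖x‖ ^ 2 - 2 * ((2 * b)⁻¹ * ⟪x, w⟫)
        + (2 * b)⁻¹ ^ 2 * ‖w‖ ^ 2 := by
      rw [← sub_eq_add_neg, norm_sub_sq_real, inner_smul_right, norm_smul, mul_pow,
        Real.norm_eq_abs, sq_abs]
    rw [e]
    field_simp
    ring
  · exact measurable_eexp.comp (by fun_prop)

/-- the rotation by 45 degrees -/
def rotL (n : ℕ) : (Euc n × Euc n) →ₗ[ℝ] (Euc n × Euc n) where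
  toFun z := ((√2)⁻¹ • (z.1 + z.2), (√2)⁻¹ • (z.1 - z.2))
  map_add' x y := by
    ext <;> simp <;> ring
  map_smul' c x := by
    ext <;> simp <;> ring

theorem inv_sqrt_two_sq : (√2)⁻¹ * (√2)⁻¹ = (2⁻¹ : ℝ) := by
  rw [← mul_inv]; simp

theorem rotL_rotL (z : Euc n × Euc n) : rotL n (rotL n z) = z := by
  have h := inv_sqrt_two_sq
  ext i <;> simp [rotL]
  · linear_combination (2 * z.1 i) * h
  · linear_combination (2 * z.2 i) * h

theorem rot_mp : MeasurePreserving (rotL n) volume volume := by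
  have hdet : LinearMap.det (rotL n) * LinearMap.det (rotL n) = 1 := by
    rw [← LinearMap.det_comp]
    have : (rotL n) ∘ₗ (rotL n) = LinearMap.id := LinearMap.ext rotL_rotL
    rw [this, LinearMap.det_id]
  have h0 : LinearMap.det (rotL n) ≠ 0 := fun h => by rw [h] at hdet; simp at hdet
  refine ⟨(rotL n).continuous_of_finiteDimensional.measurable, ?_⟩
  haveI : (volume : Measure (Euc n × Euc n)).IsAddHaarMeasure := by
    rw [Measure.volume_eq_prod]; infer_instance
  have h := Measure.map_linearMap_addHaar_eq_smul_addHaar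
    (volume : Measure (Euc n × Euc n)) h0
  rw [h]
  have : |(LinearMap.det (rotL n))⁻¹| = 1 := by
    rcases mul_self_eq_one_iff.1 hdet with h | h <;> rw [h] <;> simp
  rw [this]; simp

theorem rot_lint {F : Euc n → Euc n → ℝ≥0∞} (hF : Measurable (Function.uncurry F)) :
    ∫⁻ u, ∫⁻ v, F ((√2)⁻¹ • (u + v)) ((√2)⁻¹ • (u - v)) = ∫⁻ u, ∫⁻ v, F u v := by
  have h := (rot_mp (n := n)).lintegral_comp hF
  have hr : Measurable (rotL n) := (rotL n).continuous_of_finiteDimensional.measurable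
  change ∫⁻ a, (Function.uncurry F ∘ rotL n) a = _ at h
  rw [Measure.volume_eq_prod, lintegral_prod _ (hF.comp hr).aemeasurable,
    lintegral_prod _ hF.aemeasurable] at h
  exact h

/-- Cauchy-Schwarz -/
theorem cs_lint {f g h : Euc n → ℝ≥0∞} (hf : Measurable f) (hg : Measurable g)
    (H : ∀ x, h x ^ 2 ≤ f x * g x) : (∫⁻ x, h x) ^ 2 ≤ (∫⁻ x, f x) * ∫⁻ x, g x := by
  have h1 := ENNReal.lintegral_mul_le_Lp_mul_Lq (volume : Measure (Euc n))
    Real.HolderConjugate.two_two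
    (hf.pow_const (2⁻¹ : ℝ)).aemeasurable (hg.pow_const (2⁻¹ : ℝ)).aemeasurable
  have h2 : ∀ x, h x ≤ f x ^ (2⁻¹ : ℝ) * g x ^ (2⁻¹ : ℝ) := by
    intro x
    rw [← ENNReal.mul_rpow_of_nonneg _ _ (by norm_num : (0 : ℝ) ≤ 2⁻¹)]
    have := ENNReal.rpow_le_rpow (H x) (by norm_num : (0 : ℝ) ≤ 2⁻¹)
    rwa [← ENNReal.rpow_natCast, ← ENNReal.rpow_mul, show ((2 : ℕ) : ℝ) * 2⁻¹ = 1 by norm_num,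
      ENNReal.rpow_one] at this
  have h3 := (lintegral_mono h2).trans h1
  simp only [← ENNReal.rpow_mul] at h3
  norm_num at h3
  rw [← ENNReal.mul_rpow_of_nonneg _ _ (by norm_num : (0 : ℝ) ≤ 1 / 2)] at h3
  calc _ ≤ _ := pow_le_pow_left' h3 2
    _ = _ := by
      rw [← ENNReal.rpow_natCast, ← ENNReal.rpow_mul]; norm_num

/-- Minkowski's integral inequality -/
theorem mink {K : Euc n → Euc n → ℝ≥0∞} (hK : Measurable (Function.uncurry K)) {q : ℝ}
    (hq : 1 < q) (hfin : ∫⁻ u, (∫⁻ v, K u v) ^ q ≠ ⊤) :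
    (∫⁻ u, (∫⁻ v, K u v) ^ q) ^ (1 / q) ≤ ∫⁻ v, (∫⁻ u, K u v ^ q) ^ (1 / q) := by
  set G : Euc n → ℝ≥0∞ := fun u => ∫⁻ v, K u v with hG
  have hGm : Measurable G := Measurable.lintegral_prod_right' hK
  set X := ∫⁻ u, G u ^ q with hX
  have hq0 : 0 < q := by linarith
  by_cases hX0 : X = 0
  · rw [hX0, ENNReal.zero_rpow_of_pos (by positivity)]; exact zero_le
  obtain ⟨r, hr⟩ : ∃ r, r = q / (q - 1) := ⟨_, rfl⟩
  have hconj : r.HolderConjugate q := by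
    rw [hr]; exact (Real.HolderConjugate.conjExponent hq).symm
  have e1 : X = ∫⁻ v, ∫⁻ u, G u ^ (q - 1) * K u v := by
    rw [lintegral_lintegral_swap, hX]
    · apply lintegral_congr
      intro u
      rw [lintegral_const_mul _ (show Measurable (fun v => K u v) from hK.comp measurable_prodMk_left)]
      change _ = G u ^ (q - 1) * G u
      nth_rewrite 3 [← ENNReal.rpow_one (G u)]
      rw [← ENNReal.rpow_add_of_nonneg _ _ (by linarith) (by norm_num)]
      congr 1; ring
    · exact (Measurable.mul ((hGm.comp measurable_snd).pow_const _)
        (hK.comp measurable_swap)).aemeasurable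
  have e2 : X ≤ ∫⁻ v, X ^ (1 / r) * (∫⁻ u, K u v ^ q) ^ (1 / q) := by
    conv_lhs => rw [e1]
    apply lintegral_mono
    intro v
    have := ENNReal.lintegral_mul_le_Lp_mul_Lq (volume : Measure (Euc n)) hconj
      (hGm.pow_const (q - 1)).aemeasurable
      (g := fun u => K u v) (hK.comp measurable_prodMk_right).aemeasurable
    refine this.trans (le_of_eq ?_)
    congr 2
    apply lintegral_congr
    intro u
    rw [← ENNReal.rpow_mul]
    congr 1
    rw [hr]
    have : q - 1 ≠ 0 := by linarith
    field_simp
  rw [lintegral_const_mul] at e2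
  · have e3 : X = X ^ (1 / r) * X ^ (1 / q) := by
      rw [← ENNReal.rpow_add _ _ hX0 hfin]
      have := hconj.inv_add_inv_eq_one
      rw [one_div, one_div, this, ENNReal.rpow_one]
    nth_rewrite 1 [e3] at e2
    have hne : X ^ (1 / r) ≠ 0 := by
      simp [hX0, hfin]
    have hnt : X ^ (1 / r) ≠ ⊤ := by
      apply ENNReal.rpow_ne_top_of_nonneg _ hfin
      rw [one_div]; exact (inv_pos.2 hconj.pos).le
    exact (ENNReal.mul_le_mul_iff_right hne hnt).1 e2
  · apply Measurable.pow_const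
    exact Measurable.lintegral_prod_left' (hK.pow_const q)

/-- marginals of strongly log-concave functions -/
theorem marg_up {K : Euc n → Euc n → ℝ≥0∞} (hK : Measurable (Function.uncurry K)) {A : ℝ}
    (H : ∀ u v s z, K (u + s) (v + z) * K (u - s) (v - z) ≤ K u v ^ 2 * eexp (-(A * ‖z‖ ^ 2)))
    (v z : Euc n) : (∫⁻ u, K u (v + z)) * (∫⁻ u, K u (v - z)) ≤
      (∫⁻ u, K u v) ^ 2 * eexp (-(A * ‖z‖ ^ 2)) := by
  have hm : ∀ v, Measurable (fun u => K u v) := fun v => hK.comp measurable_prodMk_right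
  have := pl_euc n (fun u => K u (v + z)) (fun u => K u (v - z))
    (fun u => K u v * eexp (-(A * ‖z‖ ^ 2) / 2)) (hm _) (hm _) ((hm _).mul_const _) ?_
  · rw [lintegral_mul_const _ (hm v), mul_pow, eexp_sq] at this
    convert this using 3
    ring
  · intro x y
    have := H ((2⁻¹ : ℝ) • (x + y)) v ((2⁻¹ : ℝ) • (x - y)) z
    rw [mul_pow, eexp_sq]
    convert this using 2
    · congr 1; ext i; simp; ring
    · congr 1; ext i; simp; ring
    · congr 1; ring

theorem marg_lo {K : Euc n → Euc n → ℝ≥0∞} (hK : Measurable (Function.uncurry K)) {B : ℝ}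
    (H : ∀ u v z, K u v ^ 2 * eexp (-(B * ‖z‖ ^ 2)) ≤ K u (v + z) * K u (v - z))
    (v z : Euc n) : (∫⁻ u, K u v) ^ 2 * eexp (-(B * ‖z‖ ^ 2)) ≤
      (∫⁻ u, K u (v + z)) * (∫⁻ u, K u (v - z)) := by
  have hm : ∀ v, Measurable (fun u => K u v) := fun v => hK.comp measurable_prodMk_right
  have := cs_lint (h := fun u => K u v * eexp (-(B * ‖z‖ ^ 2) / 2)) (hm (v + z)) (hm (v - z)) ?_
  · rw [lintegral_mul_const _ (hm v), mul_pow, eexp_sq] at this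
    convert this using 3
    ring
  · intro x
    rw [mul_pow, eexp_sq]
    convert H x v z using 3
    ring

end

section

variable {n : ℕ}

/-- uniformly log-concave and semi-log-convex centered probability densities -/
structure Cls (A B : ℝ) (ρ : Euc n → ℝ≥0∞) : Prop where
  meas : Measurable ρ
  up : ∀ x z, ρ (x + z) * ρ (x - z) ≤ ρ x ^ 2 * eexp (-(A * ‖z‖ ^ 2))
  lo : ∀ x z, ρ x ^ 2 * eexp (-(B * ‖z‖ ^ 2)) ≤ ρ (x + z) * ρ (x - z)
  mass : ∫⁻ x, ρ x = 1
  cent : ∫ x, (ρ x).toReal • x = 0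

theorem le_add_of_sq_le {X a b : ℝ≥0∞} (h : X ^ 2 ≤ a * b) : X ≤ a + b := by
  by_contra hc
  push Not at hc
  have h1 : a * b ≤ (a + b) * (a + b) := mul_le_mul' le_self_add le_add_self
  have h2 : (a + b) ^ 2 < X ^ 2 := ENNReal.pow_lt_pow_left (by norm_num) hc
  rw [sq (a + b)] at h2
  exact absurd (h2.trans_le h) (not_lt.2 h1)

theorem lin_le_eexp {a : ℝ} (ha : 0 < a) (x : Euc n) :
    ‖x‖ₑ ≤ ENNReal.ofReal (1 + 1 / a) * eexp (a * ‖x‖ ^ 2) := by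
  rw [eexp, ← ENNReal.ofReal_mul (by positivity), ← ofReal_norm]
  apply ENNReal.ofReal_le_ofReal
  have h1 := Real.add_one_le_exp (a * ‖x‖ ^ 2)
  have h2 : ‖x‖ ≤ 1 + ‖x‖ ^ 2 := by nlinarith [sq_nonneg (‖x‖ - 1), norm_nonneg x]
  have h3 : (1 + 1 / a) * (a * ‖x‖ ^ 2 + 1) = 1 + ‖x‖ ^ 2 + (a * ‖x‖ ^ 2 + 1 / a) := by
    field_simp; ring
  have h4 : 0 ≤ a * ‖x‖ ^ 2 + 1 / a := by positivity
  have h5 : (1 + 1 / a) * (a * ‖x‖ ^ 2 + 1) ≤ (1 + 1 / a) * rexp (a * ‖x‖ ^ 2) := by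
    gcongr
  linarith

theorem gauss_fin (b : ℝ) (hb : 0 < b) : ∫⁻ x : Euc n, eexp (-(b * ‖x‖ ^ 2)) ≠ ⊤ := by
  rw [gauss_base b hb]; exact ENNReal.ofReal_ne_top

theorem gauss_ne_zero (b : ℝ) (hb : 0 < b) : ∫⁻ x : Euc n, eexp (-(b * ‖x‖ ^ 2)) ≠ 0 := by
  rw [gauss_base b hb]
  have : 0 < (π / b) ^ ((n : ℝ) / 2) := by positivity
  exact (ENNReal.ofReal_pos.2 this).ne'

theorem exists_eexp {X : ℝ≥0∞} (h0 : X ≠ 0) (ht : X ≠ ⊤) : ∃ c, X = eexp c := by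
  refine ⟨Real.log X.toReal, ?_⟩
  rw [eexp, Real.exp_log (ENNReal.toReal_pos h0 ht), ENNReal.ofReal_toReal ht]

theorem exists_le_eexp {X : ℝ≥0∞} (ht : X ≠ ⊤) : ∃ c, X ≤ eexp c := by
  refine ⟨X.toReal, ?_⟩
  rw [eexp, ENNReal.le_ofReal_iff_toReal_le ht (by positivity)]
  linarith [Real.add_one_le_exp X.toReal]

theorem lint_gauss_lin {a : ℝ} (ha : 0 < a) :
    ∫⁻ x : Euc n, ‖x‖ₑ * eexp (-(2 * a * ‖x‖ ^ 2)) ≠ ⊤ := by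
  have : ∫⁻ x : Euc n, ‖x‖ₑ * eexp (-(2 * a * ‖x‖ ^ 2)) ≤
      ∫⁻ x : Euc n, ENNReal.ofReal (1 + 1 / a) * eexp (-(a * ‖x‖ ^ 2)) := by
    apply lintegral_mono
    intro x
    calc _ ≤ (ENNReal.ofReal (1 + 1 / a) * eexp (a * ‖x‖ ^ 2)) * eexp (-(2 * a * ‖x‖ ^ 2)) := by
          exact mul_le_mul_left (lin_le_eexp ha x) _
      _ = _ := by
          rw [mul_assoc, ← eexp_add]; congr 2; ring
  refine ne_top_of_le_ne_top ?_ this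
  rw [lintegral_const_mul' _ _ ENNReal.ofReal_ne_top]
  exact ENNReal.mul_ne_top ENNReal.ofReal_ne_top (gauss_fin a ha)

/-- bound of the first moment around `t` -/
theorem bary_bound {ρ : Euc n → ℝ≥0∞} (hm : Measurable ρ) (h1 : ∫⁻ x, ρ x = 1)
    {C : ℝ≥0∞} (hC : C ≠ ⊤) {a : ℝ} (ha : 0 < a) (t : Euc n)
    (hb : ∀ x, ρ x ≤ C * eexp (-(2 * a * ‖x - t‖ ^ 2))) :
    Integrable (fun x => (ρ x).toReal • x) ∧
    ‖(∫ x, (ρ x).toReal • x) - t‖ₑ ≤ C * ∫⁻ x : Euc n, ‖x‖ₑ * eexp (-(2 * a * ‖x‖ ^ 2)) := by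
  have hfin : ∀ x, ρ x ≠ ⊤ := fun x =>
    ne_top_of_le_ne_top (ENNReal.mul_ne_top hC (eexp_ne_top _)) (hb x)
  have hi0 : Integrable (fun x => (ρ x).toReal) :=
    integrable_toReal_of_lintegral_ne_top hm.aemeasurable (by rw [h1]; simp)
  have hi1 : Integrable (fun x => (ρ x).toReal • t) := hi0.smul_const t
  have hle : ∫⁻ x, ‖(ρ x).toReal • (x - t)‖ₑ ≤
      C * ∫⁻ x : Euc n, ‖x‖ₑ * eexp (-(2 * a * ‖x‖ ^ 2)) := by
    rw [← lintegral_const_mul' _ _ hC,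
      ← lint_trans (fun x => C * (‖x‖ₑ * eexp (-(2 * a * ‖x‖ ^ 2)))) (-t)]
    apply lintegral_mono
    intro x
    simp only [← sub_eq_add_neg]
    rw [enorm_smul, mul_comm ‖x - t‖ₑ, ← mul_assoc]
    gcongr
    rw [Real.enorm_eq_ofReal ENNReal.toReal_nonneg, ENNReal.ofReal_toReal (hfin x)]
    exact hb x
  have hi2 : Integrable (fun x => (ρ x).toReal • (x - t)) := by
    refine ⟨?_, ?_⟩
    · exact (hm.ennreal_toReal.smul (measurable_id.sub_const t)).aestronglyMeasurable
    · exact lt_of_le_of_lt hle (ENNReal.mul_lt_top hC.lt_top (lint_gauss_lin ha).lt_top)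
  have e : (fun x => (ρ x).toReal • x) = fun x => (ρ x).toReal • (x - t) + (ρ x).toReal • t := by
    ext1 x; rw [← smul_add]; simp
  refine ⟨by rw [e]; exact hi2.add hi1, ?_⟩
  rw [e, integral_add hi2 hi1, integral_smul_const]
  have : ∫ x, (ρ x).toReal = 1 := by
    rw [integral_toReal hm.aemeasurable (ae_of_all _ fun x => (hfin x).lt_top), h1]; simp
  rw [this, one_smul, add_sub_cancel_right]
  exact (enorm_integral_le_lintegral_enorm _).trans hle

theorem cls_bounds (n : ℕ) {A B : ℝ} (hA : 0 < A) (hB : 0 < B) :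
    ∃ a b c d : ℝ, 0 < a ∧ 0 < b ∧ ∀ ρ : Euc n → ℝ≥0∞, Cls A B ρ →
      ∀ x, eexp (-(c + b * ‖x‖ ^ 2)) ≤ ρ x ∧ ρ x ≤ eexp (d - a * ‖x‖ ^ 2) := by
  set κ := ∫⁻ x : Euc n, eexp (-(B / 2 * ‖x‖ ^ 2)) with hκ
  have hκ0 : κ ≠ 0 := gauss_ne_zero _ (by positivity)
  have hκt : κ ≠ ⊤ := gauss_fin _ (by positivity)
  set κ₂ := ∫⁻ x : Euc n, eexp (-(A / 4 * ‖x‖ ^ 2)) with hκ₂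
  have hκ₂0 : κ₂ ≠ 0 := gauss_ne_zero _ (by positivity)
  have hκ₂t : κ₂ ≠ ⊤ := gauss_fin _ (by positivity)
  set C0 : ℝ≥0∞ := 2 / κ with hC0
  have hC0t : C0 ≠ ⊤ := ENNReal.div_ne_top (by simp) hκ0
  set D : ℝ := (2 * C0 * ∫⁻ x : Euc n, ‖x‖ₑ * eexp (-(2 * (A / 8) * ‖x‖ ^ 2))).toReal with hD
  have hDt : (2 * C0 * ∫⁻ x : Euc n, ‖x‖ₑ * eexp (-(2 * (A / 8) * ‖x‖ ^ 2))) ≠ ⊤ :=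
    ENNReal.mul_ne_top (ENNReal.mul_ne_top (by simp) hC0t) (lint_gauss_lin (by positivity))
  obtain ⟨e1, he1⟩ := exists_le_eexp (X := 2 * C0) (ENNReal.mul_ne_top (by simp) hC0t)
  obtain ⟨e2, he2⟩ := exists_le_eexp (X := 4 * κ₂) (ENNReal.mul_ne_top (by simp) hκ₂t)
  refine ⟨A / 8, 2 * B, e2 + 2 * B * D ^ 2, e1 + A / 4 * D ^ 2, by positivity, by positivity, ?_⟩
  intro ρ hρ
  have b1 : ∀ x, ρ x ≤ C0 := by
    intro x
    have h1 : ∀ z, ρ x * eexp (-(B / 2 * ‖z‖ ^ 2)) ≤ ρ (z + x) + ρ (-z + x) := by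
      intro z
      apply le_add_of_sq_le
      rw [mul_pow, eexp_sq]
      convert hρ.lo x z using 3
      · ring
      · abel
      · abel
    have h2 := lintegral_mono (μ := volume) h1
    rw [lintegral_const_mul (f := fun z => eexp (-(B / 2 * ‖z‖ ^ 2))) _ (by fun_prop),
      lintegral_add_left (f := fun z => ρ (z + x)) (hρ.meas.comp (measurable_add_const x)), lint_trans ρ x,
      lint_neg (fun z => ρ (z + x)), lint_trans ρ x, hρ.mass] at h2
    rw [hC0, ENNReal.le_div_iff_mul_le (Or.inl hκ0) (Or.inl hκt)]
    refine h2.trans (le_of_eq ?_)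
    norm_num
  set μ := ⨆ x, ρ x with hμ
  have hμC : μ ≤ C0 := iSup_le b1
  have hμt : μ ≠ ⊤ := ne_top_of_le_ne_top hC0t hμC
  have hμ0 : μ ≠ 0 := by
    intro h0
    have : ∀ x, ρ x = 0 := fun x => le_antisymm ((le_iSup ρ x).trans h0.le) zero_le
    have hh := hρ.mass
    simp [this] at hh
  have b2 : ∀ s t, ρ s * ρ t ≤ μ ^ 2 * eexp (-(A / 4 * ‖s - t‖ ^ 2)) := by
    intro s t
    have h := hρ.up ((2⁻¹ : ℝ) • (s + t)) ((2⁻¹ : ℝ) • (s - t))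
    have e1 : (2⁻¹ : ℝ) • (s + t) + (2⁻¹ : ℝ) • (s - t) = s := by ext i; simp; ring
    have e2 : (2⁻¹ : ℝ) • (s + t) - (2⁻¹ : ℝ) • (s - t) = t := by ext i; simp; ring
    rw [e1, e2] at h
    refine h.trans ?_
    have e3 : A * ‖(2⁻¹ : ℝ) • (s - t)‖ ^ 2 = A / 4 * ‖s - t‖ ^ 2 := by
      rw [norm_smul]; norm_num; ring
    rw [e3]
    gcongr
    exact le_iSup ρ _
  have b3 : μ ≤ μ ^ 2 * κ₂ := by
    apply iSup_le
    intro s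
    have h2 := lintegral_mono (μ := volume) (b2 s)
    rw [lintegral_const_mul _ hρ.meas, hρ.mass, mul_one,
      lintegral_const_mul' _ _ (ENNReal.pow_ne_top hμt)] at h2
    have e : ∫⁻ t, eexp (-(A / 4 * ‖s - t‖ ^ 2)) = κ₂ := by
      simp_rw [norm_sub_rev s, sub_eq_add_neg]
      exact lint_trans (fun x => eexp (-(A / 4 * ‖x‖ ^ 2))) (-s)
    rwa [e] at h2
  have b4 : 1 ≤ μ * κ₂ := by
    rw [sq, mul_assoc] at b3
    nth_rewrite 1 [← mul_one μ] at b3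
    exact (ENNReal.mul_le_mul_iff_right hμ0 hμt).1 b3
  obtain ⟨t, ht⟩ : ∃ t, μ / 2 < ρ t := lt_iSup_iff.1 (ENNReal.half_lt_self hμ0 hμt)
  have hμ2 : μ / 2 ≠ 0 := by simp [hμ0]
  have hμ2t : μ / 2 ≠ ⊤ := ENNReal.div_ne_top hμt (by simp)
  have hμh : μ / 2 * 2 = μ := ENNReal.div_mul_cancel (by simp) (by simp)
  have b5 : ∀ s, ρ s ≤ 2 * C0 * eexp (-(2 * (A / 8) * ‖s - t‖ ^ 2)) := by
    intro s
    have h1 : μ / 2 * ρ s ≤ μ / 2 * (2 * μ * eexp (-(2 * (A / 8) * ‖s - t‖ ^ 2))) := by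
      calc _ ≤ ρ s * ρ t := by rw [mul_comm]; gcongr
        _ ≤ _ := b2 s t
        _ = _ := by
          rw [← mul_assoc, ← mul_assoc, hμh, sq]
          congr 3; ring
    refine ((ENNReal.mul_le_mul_iff_right hμ2 hμ2t).1 h1).trans ?_
    gcongr
  have hDt' : ‖t‖ ≤ D := by
    have h := (bary_bound hρ.meas hρ.mass (ENNReal.mul_ne_top (by simp) hC0t)
      (by positivity : 0 < A / 8) t b5).2
    rw [hρ.cent, zero_sub, enorm_neg, ← ofReal_norm,
      ENNReal.ofReal_le_iff_le_toReal hDt] at h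
    exact h
  have b6 : ∀ s, eexp (-(e2 + B * ‖s - t‖ ^ 2)) ≤ ρ s := by
    intro s
    have h := hρ.lo t (s - t)
    rw [add_sub_cancel] at h
    have h1 : μ * (μ / 4 * eexp (-(B * ‖s - t‖ ^ 2))) ≤ μ * ρ s := by
      calc _ = (μ / 2) ^ 2 * eexp (-(B * ‖s - t‖ ^ 2)) := by
            rw [← mul_assoc]; congr 1
            rw [sq, ENNReal.div_eq_inv_mul, ENNReal.div_eq_inv_mul]
            rw [show (4 : ℝ≥0∞) = 2 * 2 by norm_num, ENNReal.mul_inv (by simp) (by simp)]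
            ring
        _ ≤ ρ t ^ 2 * eexp (-(B * ‖s - t‖ ^ 2)) := by gcongr
        _ ≤ _ := h
        _ ≤ ρ s * μ := by gcongr; exact le_iSup ρ _
        _ = _ := mul_comm _ _
    refine le_trans ?_ ((ENNReal.mul_le_mul_iff_right hμ0 hμt).1 h1)
    rw [neg_add, eexp_add]
    gcongr
    rw [ENNReal.le_div_iff_mul_le (by simp) (by simp)]
    calc eexp (-e2) * 4 ≤ eexp (-e2) * (4 * (μ * κ₂)) := by
          gcongr; exact le_mul_of_one_le_right' b4
      _ = eexp (-e2) * (4 * κ₂) * μ := by ring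
      _ ≤ eexp (-e2) * eexp e2 * μ := by gcongr
      _ = μ := by rw [eexp_neg_mul, one_mul]
  have hsq : ‖t‖ ^ 2 ≤ D ^ 2 := by gcongr
  intro x
  have p1 : ‖x‖ ^ 2 ≤ 2 * ‖x - t‖ ^ 2 + 2 * ‖t‖ ^ 2 := by
    have : ‖x‖ ≤ ‖x - t‖ + ‖t‖ := by simpa using norm_add_le (x - t) t
    nlinarith [sq_nonneg (‖x - t‖ - ‖t‖), norm_nonneg x]
  have p2 : ‖x - t‖ ^ 2 ≤ 2 * ‖x‖ ^ 2 + 2 * ‖t‖ ^ 2 := by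
    have := norm_sub_le x t
    nlinarith [sq_nonneg (‖x‖ - ‖t‖), norm_nonneg (x - t)]
  constructor
  · refine le_trans (eexp_mono ?_) (b6 x)
    nlinarith
  · refine (b5 x).trans ?_
    calc _ ≤ eexp e1 * eexp (-(2 * (A / 8) * ‖x - t‖ ^ 2)) := by gcongr
      _ ≤ _ := by
        rw [← eexp_add]; apply eexp_mono
        nlinarith

end

section

variable {n : ℕ}

theorem eexp_le_iff {s t : ℝ} : eexp s ≤ eexp t ↔ s ≤ t := by
  unfold eexp
  rw [ENNReal.ofReal_le_ofReal_iff (Real.exp_pos _).le, Real.exp_le_exp]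

/-- Gaussian bounds -/
def GB (a b c d : ℝ) (ρ : Euc n → ℝ≥0∞) : Prop :=
  ∀ x, eexp (-(c + b * ‖x‖ ^ 2)) ≤ ρ x ∧ ρ x ≤ eexp (d - a * ‖x‖ ^ 2)

theorem GB.log {a b c d : ℝ} {ρ : Euc n → ℝ≥0∞} (h : GB a b c d ρ) :
    ∃ φ : Euc n → ℝ, (∀ x, ρ x = eexp (φ x)) ∧
      ∀ x, -(c + b * ‖x‖ ^ 2) ≤ φ x ∧ φ x ≤ d - a * ‖x‖ ^ 2 := by
  have : ∀ x, ∃ c, ρ x = eexp c := fun x =>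
    exists_eexp (ne_of_gt (lt_of_lt_of_le (eexp_pos _) (h x).1))
      (ne_top_of_le_ne_top (eexp_ne_top _) (h x).2)
  choose φ hφ using this
  refine ⟨φ, hφ, fun x => ?_⟩
  have := h x
  rw [hφ x, eexp_le_iff, eexp_le_iff] at this
  exact this

theorem eexp_up_iff {A : ℝ} {φ : Euc n → ℝ} (x z : Euc n) :
    (eexp (φ (x + z)) * eexp (φ (x - z)) ≤ eexp (φ x) ^ 2 * eexp (-(A * ‖z‖ ^ 2))) ↔
      φ (x + z) + φ (x - z) ≤ 2 * φ x - A * ‖z‖ ^ 2 := by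
  rw [eexp_sq, ← eexp_add, ← eexp_add, eexp_le_iff, sub_eq_add_neg (2 * φ x)]

theorem eexp_lo_iff {B : ℝ} {φ : Euc n → ℝ} (x z : Euc n) :
    (eexp (φ x) ^ 2 * eexp (-(B * ‖z‖ ^ 2)) ≤ eexp (φ (x + z)) * eexp (φ (x - z))) ↔
      2 * φ x - B * ‖z‖ ^ 2 ≤ φ (x + z) + φ (x - z) := by
  rw [eexp_sq, ← eexp_add, ← eexp_add, eexp_le_iff, sub_eq_add_neg (2 * φ x)]

/-- equicontinuity of midpoint concave functions -/
theorem mid_equi {φ : Euc n → ℝ} (hc : ∀ x z, φ (x + z) + φ (x - z) ≤ 2 * φ x)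
    {K : ℝ} (x : Euc n) (hK : ∀ w, ‖w‖ ≤ 1 → |φ (x + w)| ≤ K) (k : ℕ) (w : Euc n) (hw : ‖w‖ ≤ 1) :
    |φ (x + ((2⁻¹ : ℝ) ^ k) • w) - φ x| ≤ (2⁻¹ : ℝ) ^ k * (2 * K) := by
  have low : ∀ w : Euc n, ‖w‖ ≤ 1 →
      (2⁻¹ : ℝ) ^ k * (φ (x + w) - φ x) ≤ φ (x + ((2⁻¹ : ℝ) ^ k) • w) - φ x := by
    intro w _
    induction k with
    | zero => simp
    | succ k ih =>
      have h := hc (x + ((2⁻¹ : ℝ) ^ (k + 1)) • w) (((2⁻¹ : ℝ) ^ (k + 1)) • w)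
      have e1 : x + ((2⁻¹ : ℝ) ^ (k + 1)) • w + ((2⁻¹ : ℝ) ^ (k + 1)) • w =
          x + ((2⁻¹ : ℝ) ^ k) • w := by ext i; simp [pow_succ]; ring
      rw [e1, add_sub_cancel_right] at h
      rw [pow_succ] at *
      nlinarith
  have hb : ∀ w : Euc n, ‖w‖ ≤ 1 → -(2 * K) ≤ φ (x + w) - φ x := by
    intro w hw
    have h1 := abs_le.1 (hK w hw)
    have h2 := abs_le.1 (hK 0 (by simp))
    rw [add_zero] at h2
    linarith
  have hp : (0 : ℝ) < (2⁻¹ : ℝ) ^ k := by positivity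
  have l1 := low w hw
  have l2 := low (-w) (by simpa using hw)
  have m1 := mul_le_mul_of_nonneg_left (hb w hw) hp.le
  have m2 := mul_le_mul_of_nonneg_left (hb (-w) (by simpa using hw)) hp.le
  have h := hc x (((2⁻¹ : ℝ) ^ k) • w)
  rw [smul_neg] at l2
  rw [sub_eq_add_neg x] at h
  rw [abs_le]
  constructor <;> linarith

theorem conc_subseq {φ : ℕ → Euc n → ℝ}
    (hc : ∀ k x z, φ k (x + z) + φ k (x - z) ≤ 2 * φ k x)
    {K : ℝ → ℝ} (hK : ∀ k R x, ‖x‖ ≤ R → |φ k x| ≤ K R) :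
    ∃ σ : ℕ → ℕ, StrictMono σ ∧ ∃ ψ : Euc n → ℝ,
      ∀ x, Tendsto (fun k => φ (σ k) x) atTop (nhds (ψ x)) := by
  obtain ⟨D, hDc, hDd⟩ := TopologicalSpace.exists_countable_dense (Euc n)
  haveI : Countable D := hDc.to_subtype
  have hcomp : IsCompact (Set.univ.pi fun d : D => Set.Icc (-(K ‖(d : Euc n)‖)) (K ‖(d : Euc n)‖)) :=
    isCompact_univ_pi fun d => isCompact_Icc
  obtain ⟨g, -, σ, hσ, hlim⟩ := hcomp.tendsto_subseq
    (x := fun k => fun d : D => φ k d)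
    (fun k => by
      intro d _
      have := abs_le.1 (hK k ‖(d : Euc n)‖ d le_rfl)
      exact this)
  rw [tendsto_pi_nhds] at hlim
  refine ⟨σ, hσ, ?_⟩
  have : ∀ x, ∃ y, Tendsto (fun k => φ (σ k) x) atTop (nhds y) := by
    intro x
    apply cauchySeq_tendsto_of_complete
    rw [Metric.cauchySeq_iff]
    intro ε hε
    set M := K (‖x‖ + 1)
    have hM : 0 ≤ M := (abs_nonneg _).trans (hK 0 (‖x‖ + 1) x (by linarith))
    obtain ⟨m, hm⟩ := exists_pow_lt_of_lt_one (show 0 < ε / (3 * (2 * M + 1)) by positivity)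
      (show (2⁻¹ : ℝ) < 1 by norm_num)
    obtain ⟨d, hdD, hd⟩ := Metric.dense_iff.1 hDd x ((2⁻¹ : ℝ) ^ m) (by positivity)
    rw [Metric.mem_ball, dist_eq_norm] at hdD
    have hw : ∀ k, |φ k d - φ k x| < ε / 3 := by
      intro k
      have h := mid_equi (hc k) (K := M) x (fun w hw => hK k _ _ (by
        exact (norm_add_le _ _).trans (by linarith))) m (((2 : ℝ) ^ m) • (d - x)) (by
        rw [norm_smul, Real.norm_of_nonneg (by positivity)]
        have : (2 : ℝ) ^ m * (2⁻¹ : ℝ) ^ m = 1 := by rw [← mul_pow]; norm_num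
        have h2 : (0 : ℝ) < 2 ^ m := by positivity
        nlinarith)
      rw [smul_smul, ← mul_pow] at h
      norm_num at h
      refine lt_of_le_of_lt h ?_
      rw [lt_div_iff₀ (by positivity)] at hm
      have h3 : (0 : ℝ) < (2⁻¹ : ℝ) ^ m := by positivity
      norm_num at hm h3 ⊢
      nlinarith
    obtain ⟨N, hN⟩ := Metric.cauchySeq_iff.1 (hlim ⟨d, hd⟩).cauchySeq (ε / 3) (by positivity)
    refine ⟨N, fun i hi j hj => ?_⟩
    have h1 := hN i hi j hj
    have h2 := abs_lt.1 (hw (σ i))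
    have h3 := abs_lt.1 (hw (σ j))
    rw [Real.dist_eq] at *
    simp only [Function.comp] at h1
    have h4 := abs_lt.1 h1
    rw [abs_lt]
    constructor <;> linarith
  choose ψ hψ using this
  exact ⟨ψ, hψ⟩

theorem lint_exp_sub {a d : ℝ} (ha : 0 < a) : ∫⁻ x : Euc n, eexp (d - a * ‖x‖ ^ 2) ≠ ⊤ := by
  simp_rw [sub_eq_add_neg, eexp_add]
  rw [lintegral_const_mul' _ _ (eexp_ne_top _)]
  exact ENNReal.mul_ne_top (eexp_ne_top _) (gauss_fin a ha)

theorem lint_norm_exp_sub {a d : ℝ} (ha : 0 < a) :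
    ∫⁻ x : Euc n, ‖x‖ₑ * eexp (d - a * ‖x‖ ^ 2) ≠ ⊤ := by
  have e : ∀ x : Euc n, ‖x‖ₑ * eexp (d - a * ‖x‖ ^ 2) =
      eexp d * (‖x‖ₑ * eexp (-(2 * (a / 2) * ‖x‖ ^ 2))) := by
    intro x
    rw [sub_eq_add_neg, eexp_add, mul_left_comm, show 2 * (a / 2) = a by ring]
  simp_rw [e]
  rw [lintegral_const_mul' _ _ (eexp_ne_top _)]
  exact ENNReal.mul_ne_top (eexp_ne_top _) (lint_gauss_lin (by positivity))

theorem cls_compact {A B : ℝ} (hA : 0 < A) (hB : 0 < B) {ρ : ℕ → Euc n → ℝ≥0∞}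
    (hρ : ∀ k, Cls A B (ρ k)) :
    ∃ σ : ℕ → ℕ, StrictMono σ ∧ ∃ ρ' : Euc n → ℝ≥0∞, Cls A B ρ' ∧
      ∀ x, Tendsto (fun k => ρ (σ k) x) atTop (nhds (ρ' x)) := by
  obtain ⟨a, b, c, d, ha, hb, hG⟩ := cls_bounds n hA hB
  have hG' : ∀ k, GB a b c d (ρ k) := fun k => hG _ (hρ k)
  choose φ hφ hφb using fun k => (hG' k).log
  have hup : ∀ k x z, φ k (x + z) + φ k (x - z) ≤ 2 * φ k x - A * ‖z‖ ^ 2 := by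
    intro k x z
    have := (hρ k).up x z
    rwa [hφ, hφ, hφ, eexp_up_iff] at this
  have hlo : ∀ k x z, 2 * φ k x - B * ‖z‖ ^ 2 ≤ φ k (x + z) + φ k (x - z) := by
    intro k x z
    have := (hρ k).lo x z
    rwa [hφ, hφ, hφ, eexp_lo_iff] at this
  obtain ⟨σ, hσ, ψ, hψ⟩ := conc_subseq (φ := φ) (K := fun R => |c| + |d| + b * R ^ 2)
    (fun k x z => by have := hup k x z; nlinarith [sq_nonneg ‖z‖])
    (fun k R x hx => by
      have h1 := hφb k x
      have h2 : ‖x‖ ^ 2 ≤ R ^ 2 := by gcongr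
      have h3 : b * ‖x‖ ^ 2 ≤ b * R ^ 2 := by gcongr
      have h4 : 0 ≤ a * ‖x‖ ^ 2 := by positivity
      have h5 : 0 ≤ b * ‖x‖ ^ 2 := by positivity
      rw [abs_le]
      constructor <;> linarith [le_abs_self c, le_abs_self d, abs_nonneg c, abs_nonneg d])
  have hlim : ∀ x, Tendsto (fun k => ρ (σ k) x) atTop (nhds (eexp (ψ x))) := by
    intro x
    simp_rw [hφ]
    exact (continuous_eexp.tendsto _).comp (hψ x)
  have hm : Measurable (fun x => eexp (ψ x)) :=
    measurable_of_tendsto_metrizable (fun k => (hρ (σ k)).meas) (tendsto_pi_nhds.2 hlim)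
  refine ⟨σ, hσ, fun x => eexp (ψ x), ⟨hm, ?_, ?_, ?_, ?_⟩, hlim⟩
  · intro x z
    rw [eexp_up_iff]
    exact le_of_tendsto_of_tendsto' ((hψ _).add (hψ _)) (((hψ _).const_mul 2).sub_const _)
      (fun k => hup (σ k) x z)
  · intro x z
    rw [eexp_lo_iff]
    exact le_of_tendsto_of_tendsto' (((hψ _).const_mul 2).sub_const _) ((hψ _).add (hψ _))
      (fun k => hlo (σ k) x z)
  · have h := tendsto_lintegral_of_dominated_convergence (μ := volume)
      (fun x : Euc n => eexp (d - a * ‖x‖ ^ 2))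
      (fun k => (hρ (σ k)).meas) (fun k => ae_of_all _ fun x => (hG' (σ k) x).2)
      (lint_exp_sub ha) (ae_of_all _ hlim)
    simp_rw [(hρ _).mass] at h
    exact tendsto_nhds_unique h tendsto_const_nhds
  · have hint : Integrable (fun x : Euc n => rexp (d - a * ‖x‖ ^ 2) * ‖x‖) := by
      refine ⟨by fun_prop, ?_⟩
      have := lint_norm_exp_sub (n := n) (d := d) ha
      refine lt_of_le_of_lt (lintegral_mono fun x => ?_) this.lt_top
      rw [enorm_mul, mul_comm]
      gcongr
      · simp
      · rw [Real.enorm_eq_ofReal (Real.exp_pos _).le]; rfl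
    have h := tendsto_integral_of_dominated_convergence (μ := volume)
      (F := fun k x => (ρ (σ k) x).toReal • x) (f := fun x => (eexp (ψ x)).toReal • x)
      (fun x : Euc n => rexp (d - a * ‖x‖ ^ 2) * ‖x‖)
      (fun k => ((hρ (σ k)).meas.ennreal_toReal.smul measurable_id).aestronglyMeasurable)
      hint (fun k => ae_of_all _ fun x => by
        rw [norm_smul, Real.norm_of_nonneg ENNReal.toReal_nonneg]
        gcongr
        exact ENNReal.toReal_le_of_le_ofReal (Real.exp_pos _).le (hG' (σ k) x).2)
      (ae_of_all _ fun x => by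
        apply Tendsto.smul_const
        exact (ENNReal.tendsto_toReal (eexp_ne_top _)).comp (hlim x))
    simp_rw [(hρ _).cent] at h
    exact tendsto_nhds_unique h tendsto_const_nhds

end

section

variable {n : ℕ}

/-- `∫ e^{p⟨x,y⟩} ρ^{p+1}` -/
def LpT (p : ℝ) (ρ : Euc n → ℝ≥0∞) (y : Euc n) : ℝ≥0∞ :=
  ∫⁻ x, eexp (p * ⟪x, y⟫) * ρ x ^ (p + 1)

/-- `∫ (LpT)^{-1/p}` -/
def JT (p : ℝ) (ρ : Euc n → ℝ≥0∞) : ℝ≥0∞ := ∫⁻ y, LpT p ρ y ^ (-(1 / p))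

theorem LpT_meas (p : ℝ) {ρ : Euc n → ℝ≥0∞} (hρ : Measurable ρ) : Measurable (LpT p ρ) := by
  have : Measurable (fun z : Euc n × Euc n => eexp (p * ⟪z.2, z.1⟫) * ρ z.2 ^ (p + 1)) := by
    fun_prop
  exact Measurable.lintegral_prod_right' this

theorem gauss_lint' (p : ℝ) (a d : ℝ) (ha : 0 < a) (y : Euc n) :
    ∫⁻ x : Euc n, eexp (p * ⟪x, y⟫ + (d - a * ‖x‖ ^ 2)) =
      eexp d * (ENNReal.ofReal ((π / a) ^ ((n : ℝ) / 2)) * eexp (p ^ 2 / (4 * a) * ‖y‖ ^ 2)) := by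
  have h := gauss_lint a ha (p • y)
  rw [norm_smul, mul_pow, Real.norm_eq_abs, sq_abs] at h
  rw [show p ^ 2 / (4 * a) * ‖y‖ ^ 2 = p ^ 2 * ‖y‖ ^ 2 / (4 * a) by ring, ← h,
    ← lintegral_const_mul' _ _ (eexp_ne_top _)]
  apply lintegral_congr
  intro x
  rw [← eexp_add, inner_smul_right]
  congr 1; ring

theorem LpT_bounds (n : ℕ) {p : ℝ} (hp : 0 < p) {a b c d : ℝ} (ha : 0 < a) (hb : 0 < b) :
    ∃ a' b' c' d' : ℝ, 0 < b' ∧ ∀ ρ : Euc n → ℝ≥0∞, GB a b c d ρ → ∀ y,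
      eexp (c' + b' * ‖y‖ ^ 2) ≤ LpT p ρ y ∧ LpT p ρ y ≤ eexp (d' + a' * ‖y‖ ^ 2) := by
  have hp1 : 0 < p + 1 := by linarith
  have hx : ∀ t : ℝ, 0 < t → ∃ e, ENNReal.ofReal ((π / t) ^ ((n : ℝ) / 2)) = eexp e := by
    intro t ht
    exact exists_eexp (ENNReal.ofReal_pos.2 (by positivity)).ne' ENNReal.ofReal_ne_top
  obtain ⟨e1, he1⟩ := hx ((p + 1) * a) (by positivity)
  obtain ⟨e2, he2⟩ := hx ((p + 1) * b) (by positivity)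
  refine ⟨p ^ 2 / (4 * ((p + 1) * a)), p ^ 2 / (4 * ((p + 1) * b)), -((p + 1) * c) + e2,
    (p + 1) * d + e1, by positivity, ?_⟩
  intro ρ hρ y
  constructor
  · rw [eexp_add, eexp_add, ← he2, mul_assoc, ← gauss_lint' p ((p + 1) * b) _ (by positivity)]
    apply lintegral_mono
    intro x
    change _ ≤ eexp (p * ⟪x, y⟫) * ρ x ^ (p + 1)
    have := ENNReal.rpow_le_rpow (hρ x).1 hp1.le
    rw [eexp_rpow] at this
    beta_reduce
    rw [eexp_add]
    gcongr
    refine le_trans (le_of_eq ?_) this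
    congr 1; ring
  · rw [eexp_add, eexp_add, ← he1, mul_assoc, ← gauss_lint' p ((p + 1) * a) _ (by positivity)]
    apply lintegral_mono
    intro x
    change eexp (p * ⟪x, y⟫) * ρ x ^ (p + 1) ≤ _
    have := ENNReal.rpow_le_rpow (hρ x).2 hp1.le
    rw [eexp_rpow] at this
    beta_reduce
    rw [eexp_add]
    gcongr
    refine this.trans (le_of_eq ?_)
    congr 1; ring

theorem neg_rpow_anti {X Y : ℝ≥0∞} {r : ℝ} (hr : 0 ≤ r) (h : X ≤ Y) : Y ^ (-r) ≤ X ^ (-r) := by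
  rw [ENNReal.rpow_neg, ENNReal.rpow_neg]
  exact ENNReal.inv_le_inv.2 (ENNReal.rpow_le_rpow h hr)

theorem JT_tendsto {A B p : ℝ} (hA : 0 < A) (hB : 0 < B) (hp : 0 < p) {ρ : ℕ → Euc n → ℝ≥0∞}
    {ρ' : Euc n → ℝ≥0∞} (hρ : ∀ k, Cls A B (ρ k))
    (hlim : ∀ x, Tendsto (fun k => ρ k x) atTop (nhds (ρ' x))) :
    Tendsto (fun k => JT p (ρ k)) atTop (nhds (JT p ρ')) := by
  obtain ⟨a, b, c, d, ha, hb, hG⟩ := cls_bounds n hA hB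
  obtain ⟨a', b', c', d', hb', hL⟩ := LpT_bounds n hp (c := c) (d := d) ha hb
  have hG' : ∀ k, GB a b c d (ρ k) := fun k => hG _ (hρ k)
  have hp1 : 0 < p + 1 := by linarith
  have h1 : ∀ y, Tendsto (fun k => LpT p (ρ k) y) atTop (nhds (LpT p ρ' y)) := by
    intro y
    refine tendsto_lintegral_of_dominated_convergence
      (fun x : Euc n => eexp (p * ⟪x, y⟫ + ((p + 1) * d - (p + 1) * a * ‖x‖ ^ 2)))
      (fun k => ?_) (fun k => ae_of_all _ fun x => ?_) ?_ (ae_of_all _ fun x => ?_)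
    · have := (hρ k).meas
      fun_prop
    · have := ENNReal.rpow_le_rpow (hG' k x).2 hp1.le
      rw [eexp_rpow] at this
      beta_reduce
      rw [eexp_add]
      gcongr
      refine this.trans (le_of_eq ?_)
      congr 1; ring
    · rw [gauss_lint' _ _ _ (by positivity)]
      exact ENNReal.mul_ne_top (eexp_ne_top _)
        (ENNReal.mul_ne_top ENNReal.ofReal_ne_top (eexp_ne_top _))
    · apply ENNReal.Tendsto.const_mul _ (Or.inr (eexp_ne_top _))
      exact (ENNReal.continuous_rpow_const.tendsto _).comp (hlim x)
  refine tendsto_lintegral_of_dominated_convergence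
    (fun y : Euc n => eexp (-(c' / p) - b' / p * ‖y‖ ^ 2))
    (fun k => ?_) (fun k => ae_of_all _ fun x => ?_) ?_ (ae_of_all _ fun x => ?_)
  · exact (LpT_meas p (hρ k).meas).pow_const _
  · have := neg_rpow_anti (r := 1 / p) (by positivity) (hL _ (hG' k) x).1
    rw [eexp_rpow] at this
    refine this.trans (le_of_eq ?_)
    congr 1
    field_simp
    ring
  · exact lint_exp_sub (by positivity)
  · exact (ENNReal.continuous_rpow_const.tendsto _).comp (h1 x)

theorem JT_fin {A B p : ℝ} (hA : 0 < A) (hB : 0 < B) (hp : 0 < p) :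
    ∃ C : ℝ≥0∞, C ≠ ⊤ ∧ ∀ ρ : Euc n → ℝ≥0∞, Cls A B ρ → JT p ρ ≤ C := by
  obtain ⟨a, b, c, d, ha, hb, hG⟩ := cls_bounds n hA hB
  obtain ⟨a', b', c', d', hb', hL⟩ := LpT_bounds n hp (c := c) (d := d) ha hb
  refine ⟨∫⁻ y : Euc n, eexp (-(c' / p) - b' / p * ‖y‖ ^ 2), lint_exp_sub (by positivity), ?_⟩
  intro ρ hρ
  apply lintegral_mono
  intro x
  have := neg_rpow_anti (r := 1 / p) (by positivity) (hL _ (hG _ hρ) x).1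
  rw [eexp_rpow] at this
  refine this.trans (le_of_eq ?_)
  congr 1
  field_simp
  ring

theorem LpT_ne_top {A B p : ℝ} (hA : 0 < A) (hB : 0 < B) (hp : 0 < p) {ρ : Euc n → ℝ≥0∞}
    (hρ : Cls A B ρ) (y : Euc n) : LpT p ρ y ≠ ⊤ := by
  obtain ⟨a, b, c, d, ha, hb, hG⟩ := cls_bounds n hA hB
  obtain ⟨a', b', c', d', hb', hL⟩ := LpT_bounds n hp (c := c) (d := d) ha hb
  exact ne_top_of_le_ne_top (eexp_ne_top _) (hL ρ (hG ρ hρ) y).2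

theorem LpT_ne_zero {A B p : ℝ} (hA : 0 < A) (hB : 0 < B) (hp : 0 < p) {ρ : Euc n → ℝ≥0∞}
    (hρ : Cls A B ρ) (y : Euc n) : LpT p ρ y ≠ 0 := by
  obtain ⟨a, b, c, d, ha, hb, hG⟩ := cls_bounds n hA hB
  obtain ⟨a', b', c', d', hb', hL⟩ := LpT_bounds n hp (c := c) (d := d) ha hb
  exact (lt_of_lt_of_le (eexp_pos _) (hL ρ (hG ρ hρ) y).1).ne'

theorem JT_ne_zero {A B p : ℝ} (hA : 0 < A) (hB : 0 < B) (hp : 0 < p) {ρ : Euc n → ℝ≥0∞}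
    (hρ : Cls A B ρ) : JT p ρ ≠ 0 := by
  intro h
  unfold JT at h
  rw [lintegral_eq_zero_iff ((LpT_meas p hρ.meas).pow_const _)] at h
  obtain ⟨y, hy⟩ := h.exists
  simp only [Pi.zero_apply, ENNReal.rpow_eq_zero_iff] at hy
  rcases hy with h | h
  · exact LpT_ne_zero hA hB hp hρ y h.1
  · exact LpT_ne_top hA hB hp hρ y h.1

theorem exists_max {A B p : ℝ} (hA : 0 < A) (hB : 0 < B) (hp : 0 < p) {ρ₀ : Euc n → ℝ≥0∞}
    (h0 : Cls A B ρ₀) :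
    ∃ ρ : Euc n → ℝ≥0∞, Cls A B ρ ∧ ∀ ρ' : Euc n → ℝ≥0∞, Cls A B ρ' → JT p ρ' ≤ JT p ρ := by
  set T : Set ℝ≥0∞ := {t | ∃ ρ : Euc n → ℝ≥0∞, Cls A B ρ ∧ JT p ρ = t} with hT
  have hne : T.Nonempty := ⟨_, ρ₀, h0, rfl⟩
  obtain ⟨u, -, hu, huT⟩ := exists_seq_tendsto_sSup hne (OrderTop.bddAbove T)
  choose ρ hρ hJ using huT
  obtain ⟨σ, hσ, ρ', hρ', hlim⟩ := cls_compact hA hB hρ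
  refine ⟨ρ', hρ', fun r hr => ?_⟩
  have h1 := JT_tendsto hA hB hp (fun k => hρ (σ k)) hlim
  simp_rw [hJ] at h1
  have h2 := tendsto_nhds_unique h1 (hu.comp hσ.tendsto_atTop)
  rw [h2]
  exact le_sSup ⟨r, hr, rfl⟩

end

section

variable {n : ℕ}

/-- rotated product density -/
def rotR (ρ : Euc n → ℝ≥0∞) (u v : Euc n) : ℝ≥0∞ :=
  ρ ((√2)⁻¹ • (u + v)) * ρ ((√2)⁻¹ • (u - v))

/-- density of `(X+Y)/√2` -/
def conv2 (ρ : Euc n → ℝ≥0∞) (u : Euc n) : ℝ≥0∞ := ∫⁻ v, rotR ρ u v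

theorem rotR_meas {ρ : Euc n → ℝ≥0∞} (hρ : Measurable ρ) :
    Measurable (Function.uncurry (rotR ρ)) := by
  unfold rotR Function.uncurry
  fun_prop

theorem rot_norm (s z : Euc n) :
    ‖(√2)⁻¹ • (s + z)‖ ^ 2 + ‖(√2)⁻¹ • (s - z)‖ ^ 2 = ‖s‖ ^ 2 + ‖z‖ ^ 2 := by
  have h := parallelogram_law_with_norm ℝ s z
  rw [norm_smul, norm_smul, mul_pow, mul_pow, Real.norm_eq_abs, sq_abs, sq (√2)⁻¹,
    inv_sqrt_two_sq]
  nlinarith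

theorem rot_inner (u v s z : Euc n) :
    ⟪(√2)⁻¹ • (u + v), (√2)⁻¹ • (s + z)⟫ + ⟪(√2)⁻¹ • (u - v), (√2)⁻¹ • (s - z)⟫ =
      ⟪u, s⟫ + ⟪v, z⟫ := by
  simp only [inner_smul_left, inner_smul_right, inner_add_left, inner_add_right, inner_sub_left,
    inner_sub_right, RCLike.conj_to_real]
  linear_combination (2 * ⟪u, s⟫ + 2 * ⟪v, z⟫) * inv_sqrt_two_sq

theorem rotR_up {A B : ℝ} {ρ : Euc n → ℝ≥0∞} (hρ : Cls A B ρ) (u v s z : Euc n) :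
    rotR ρ (u + s) (v + z) * rotR ρ (u - s) (v - z) ≤
      rotR ρ u v ^ 2 * eexp (-(A * (‖s‖ ^ 2 + ‖z‖ ^ 2))) := by
  have h1 := hρ.up ((√2)⁻¹ • (u + v)) ((√2)⁻¹ • (s + z))
  have h2 := hρ.up ((√2)⁻¹ • (u - v)) ((√2)⁻¹ • (s - z))
  have h := mul_le_mul' h1 h2
  rw [← rot_norm, mul_add, neg_add, eexp_add]
  unfold rotR
  refine le_of_eq_of_le ?_ (h.trans_eq ?_)
  · rw [show (√2)⁻¹ • (u + s + (v + z)) = (√2)⁻¹ • (u + v) + (√2)⁻¹ • (s + z) by module,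
      show (√2)⁻¹ • (u + s - (v + z)) = (√2)⁻¹ • (u - v) + (√2)⁻¹ • (s - z) by module,
      show (√2)⁻¹ • (u - s + (v - z)) = (√2)⁻¹ • (u + v) - (√2)⁻¹ • (s + z) by module,
      show (√2)⁻¹ • (u - s - (v - z)) = (√2)⁻¹ • (u - v) - (√2)⁻¹ • (s - z) by module]
    ring
  · ring

theorem rotR_lo {A B : ℝ} {ρ : Euc n → ℝ≥0∞} (hρ : Cls A B ρ) (u v s z : Euc n) :
    rotR ρ u v ^ 2 * eexp (-(B * (‖s‖ ^ 2 + ‖z‖ ^ 2))) ≤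
    rotR ρ (u + s) (v + z) * rotR ρ (u - s) (v - z) := by
  have h1 := hρ.lo ((√2)⁻¹ • (u + v)) ((√2)⁻¹ • (s + z))
  have h2 := hρ.lo ((√2)⁻¹ • (u - v)) ((√2)⁻¹ • (s - z))
  have h := mul_le_mul' h1 h2
  rw [← rot_norm, mul_add, neg_add, eexp_add]
  unfold rotR
  refine le_of_eq_of_le ?_ (h.trans_eq ?_)
  · ring
  · rw [show (√2)⁻¹ • (u + s + (v + z)) = (√2)⁻¹ • (u + v) + (√2)⁻¹ • (s + z) by module,
      show (√2)⁻¹ • (u + s - (v + z)) = (√2)⁻¹ • (u - v) + (√2)⁻¹ • (s - z) by module,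
      show (√2)⁻¹ • (u - s + (v - z)) = (√2)⁻¹ • (u + v) - (√2)⁻¹ • (s + z) by module,
      show (√2)⁻¹ • (u - s - (v - z)) = (√2)⁻¹ • (u - v) - (√2)⁻¹ • (s - z) by module]
    ring

/-- measure with density -/
def mu (ρ : Euc n → ℝ≥0∞) : Measure (Euc n) := volume.withDensity ρ

theorem mu_prob {A B : ℝ} {ρ : Euc n → ℝ≥0∞} (hρ : Cls A B ρ) : IsProbabilityMeasure (mu ρ) :=
  ⟨by rw [mu, withDensity_apply _ MeasurableSet.univ, Measure.restrict_univ, hρ.mass]⟩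

theorem conv2_meas {ρ : Euc n → ℝ≥0∞} (hρ : Measurable ρ) : Measurable (conv2 ρ) :=
  Measurable.lintegral_prod_right' (rotR_meas hρ)

theorem rot_fst (u v : Euc n) : (√2)⁻¹ • ((√2)⁻¹ • (u + v) + (√2)⁻¹ • (u - v)) = u := by
  rw [← smul_add, smul_smul, inv_sqrt_two_sq]; module

theorem mu_conv2 {A B : ℝ} {ρ : Euc n → ℝ≥0∞} (hρ : Cls A B ρ) :
    mu (conv2 ρ) = ((mu ρ).conv (mu ρ)).map (fun x => (√2)⁻¹ • x) := by
  have := mu_prob hρ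
  have hm := hρ.meas
  apply Measure.ext_of_lintegral
  intro f hf
  rw [lintegral_map hf (by fun_prop), Measure.lintegral_conv (by fun_prop)]
  unfold mu
  rw [lintegral_withDensity_eq_lintegral_mul _ (conv2_meas hm) hf,
    lintegral_withDensity_eq_lintegral_mul _ hm]
  · simp only [Pi.mul_apply]
    have e : ∀ x, ∫⁻ y, f ((√2)⁻¹ • (x + y)) ∂(volume.withDensity ρ) =
        ∫⁻ y, ρ y * f ((√2)⁻¹ • (x + y)) := by
      intro x
      rw [lintegral_withDensity_eq_lintegral_mul _ hm (by fun_prop)]; rfl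
    simp_rw [e]
    have h := rot_lint (F := fun x y => ρ x * (ρ y * f ((√2)⁻¹ • (x + y)))) (by
      unfold Function.uncurry; fun_prop)
    simp_rw [rot_fst] at h
    have e2 : ∀ x, ρ x * ∫⁻ y, ρ y * f ((√2)⁻¹ • (x + y)) =
        ∫⁻ y, ρ x * (ρ y * f ((√2)⁻¹ • (x + y))) := by
      intro x
      rw [lintegral_const_mul (f := fun y => ρ y * f ((√2)⁻¹ • (x + y))) _ (by fun_prop)]
    simp_rw [e2]
    rw [← h]
    apply lintegral_congr
    intro u
    unfold conv2
    rw [← lintegral_mul_const (f := rotR ρ u) _ ((rotR_meas hm).comp measurable_prodMk_left)]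
    apply lintegral_congr
    intro v
    unfold rotR
    ring
  · have : Measurable (fun z : Euc n × Euc n => f ((√2)⁻¹ • (z.1 + z.2))) := by fun_prop
    exact Measurable.lintegral_prod_right' (ν := volume.withDensity ρ) this

theorem cls_ne_top {A B : ℝ} (hA : 0 < A) (hB : 0 < B) {ρ : Euc n → ℝ≥0∞} (hρ : Cls A B ρ)
    (x : Euc n) : ρ x ≠ ⊤ := by
  obtain ⟨a, b, c, d, ha, hb, hG⟩ := cls_bounds n hA hB
  exact ne_top_of_le_ne_top (eexp_ne_top _) (hG ρ hρ x).2

theorem mu_integral {ρ : Euc n → ℝ≥0∞} (hm : Measurable ρ) (ht : ∀ x, ρ x ≠ ⊤) :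
    ∫ x, x ∂(mu ρ) = ∫ x, (ρ x).toReal • x := by
  unfold mu
  rw [integral_withDensity_eq_integral_toReal_smul hm (ae_of_all _ fun x => (ht x).lt_top)]

theorem cls_integrable {A B : ℝ} (hA : 0 < A) (hB : 0 < B) {ρ : Euc n → ℝ≥0∞} (hρ : Cls A B ρ) :
    Integrable (fun x => x) (mu ρ) := by
  obtain ⟨a, b, c, d, ha, hb, hG⟩ := cls_bounds n hA hB
  unfold mu
  rw [integrable_withDensity_iff_integrable_smul' hρ.meas
    (ae_of_all _ fun x => (cls_ne_top hA hB hρ x).lt_top)]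
  refine (bary_bound hρ.meas hρ.mass (eexp_ne_top d) (a := a / 2) (by positivity) 0 ?_).1
  intro x
  refine (hG ρ hρ x).2.trans (le_of_eq ?_)
  rw [← eexp_add]; congr 1; rw [sub_zero]; ring

theorem cls_conv2 {A B : ℝ} (hA : 0 < A) (hB : 0 < B) {ρ : Euc n → ℝ≥0∞} (hρ : Cls A B ρ) :
    Cls A B (conv2 ρ) := by
  have hm := hρ.meas
  have hK : Measurable (Function.uncurry (fun u v => rotR ρ v u)) :=
    (rotR_meas hm).comp measurable_swap
  have hmass : ∫⁻ x, conv2 ρ x = 1 := by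
    have h := rot_lint (F := fun x y => ρ x * ρ y) (by unfold Function.uncurry; fun_prop)
    refine h.trans ?_
    simp_rw [lintegral_const_mul _ hm, hρ.mass, mul_one, hρ.mass]
  have hup : ∀ x z, conv2 ρ (x + z) * conv2 ρ (x - z) ≤
      conv2 ρ x ^ 2 * eexp (-(A * ‖z‖ ^ 2)) := by
    refine marg_up hK (fun u v s z => (rotR_up hρ v u z s).trans ?_)
    gcongr
    apply eexp_mono
    nlinarith [sq_nonneg ‖s‖]
  have hlo : ∀ x z, conv2 ρ x ^ 2 * eexp (-(B * ‖z‖ ^ 2)) ≤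
      conv2 ρ (x + z) * conv2 ρ (x - z) := by
    refine marg_lo hK (fun u v z => ?_)
    have := rotR_lo hρ v u z 0
    simpa using this
  refine ⟨conv2_meas hm, hup, hlo, hmass, ?_⟩
  have := mu_prob hρ
  have hi := cls_integrable hA hB hρ
  have ht : ∀ x, conv2 ρ x ≠ ⊤ := by
    intro x hx
    -- finiteness from the lower bound
    have h1 : ∀ z, ⊤ ≤ conv2 ρ (x + z) * conv2 ρ (x - z) := by
      intro z
      have := hlo x z
      rw [hx] at this
      rwa [show (⊤ : ℝ≥0∞) ^ 2 = ⊤ by simp, ENNReal.top_mul (eexp_ne_zero _)] at this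
    have h2 : ∀ z, ⊤ ≤ conv2 ρ (z + x) + conv2 ρ (-z + x) := by
      intro z
      have := le_add_of_sq_le (X := ⊤) (by simpa using h1 z)
      rwa [add_comm x z, sub_eq_add_neg, add_comm x (-z)] at this
    have h3 := lintegral_mono (μ := volume) h2
    rw [lintegral_add_left (f := fun z => conv2 ρ (z + x))
      ((conv2_meas hm).comp (measurable_add_const x)), lint_trans (conv2 ρ) x,
      lint_neg (fun z => conv2 ρ (z + x)), lint_trans (conv2 ρ) x, hmass] at h3
    rw [lintegral_const] at h3
    have h4 : volume (Set.univ : Set (Euc n)) ≠ 0 := by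
      simp [NeZero.ne]
    rw [ENNReal.top_mul h4] at h3
    norm_num at h3
  rw [← mu_integral (conv2_meas hm) ht, mu_conv2 hρ,
    integral_map (by fun_prop) (by fun_prop), integral_smul, Measure.conv,
    integral_map (by fun_prop) (by fun_prop), integral_add]
  · rw [integral_fun_fst (fun x => x), integral_fun_snd (fun x => x),
      mu_integral hm (cls_ne_top hA hB hρ), hρ.cent]
    simp
  · exact hi.comp_fst _
  · exact hi.comp_snd _

theorem charFun_conv2 {A B : ℝ} {ρ : Euc n → ℝ≥0∞} (hρ : Cls A B ρ) (ξ : Euc n) :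
    charFun (mu (conv2 ρ)) ξ = charFun (mu ρ) ((√2)⁻¹ • ξ) ^ 2 := by
  have := mu_prob hρ
  rw [mu_conv2 hρ, charFun_map_smul, charFun_conv, sq]

end

section

variable {n : ℕ}

theorem rpow_up {X Y Z : ℝ≥0∞} {q t : ℝ} (hq : 0 ≤ q) (h : X * Y ≤ Z ^ 2 * eexp t) :
    X ^ q * Y ^ q ≤ (Z ^ q) ^ 2 * eexp (t * q) := by
  have := ENNReal.rpow_le_rpow h hq
  rw [ENNReal.mul_rpow_of_nonneg _ _ hq, ENNReal.mul_rpow_of_nonneg _ _ hq, eexp_rpow,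
    ← ENNReal.rpow_natCast, ← ENNReal.rpow_mul, mul_comm, mul_comm _ q, ENNReal.rpow_mul,
    ENNReal.rpow_natCast] at this
  rwa [mul_comm (X ^ q)]

theorem rpow_lo {X Y Z : ℝ≥0∞} {q t : ℝ} (hq : 0 ≤ q) (h : Z ^ 2 * eexp t ≤ X * Y) :
    (Z ^ q) ^ 2 * eexp (t * q) ≤ X ^ q * Y ^ q := by
  have := ENNReal.rpow_le_rpow h hq
  rw [ENNReal.mul_rpow_of_nonneg _ _ hq, ENNReal.mul_rpow_of_nonneg _ _ hq, eexp_rpow,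
    ← ENNReal.rpow_natCast, ← ENNReal.rpow_mul, mul_comm _ q, ENNReal.rpow_mul,
    ENNReal.rpow_natCast] at this
  exact this

theorem cls_of_even {A B : ℝ} (hA : 0 < A) {H : Euc n → ℝ≥0∞} (hm : Measurable H)
    (hup : ∀ x z, H (x + z) * H (x - z) ≤ H x ^ 2 * eexp (-(A * ‖z‖ ^ 2)))
    (hlo : ∀ x z, H x ^ 2 * eexp (-(B * ‖z‖ ^ 2)) ≤ H (x + z) * H (x - z))
    (hev : ∀ x, H (-x) = H x) (h0 : H 0 ≠ 0) (ht : H 0 ≠ ⊤) :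
    (∫⁻ x, H x) ≠ 0 ∧ (∫⁻ x, H x) ≠ ⊤ ∧ Cls A B (fun x => (∫⁻ x, H x)⁻¹ * H x) := by
  have hsq : ∀ {X Y : ℝ≥0∞}, X ^ 2 ≤ Y ^ 2 → X ≤ Y := by
    intro X Y h
    by_contra hc
    push Not at hc
    exact absurd h (not_le.2 (ENNReal.pow_lt_pow_left (by norm_num) hc))
  have hle : ∀ x, H x ≤ H 0 * eexp (-(A / 2 * ‖x‖ ^ 2)) := by
    intro x
    have := hup 0 x
    rw [zero_add, zero_sub, hev, ← sq] at this
    apply hsq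
    rw [mul_pow, eexp_sq]
    refine this.trans_eq ?_
    congr 2; ring
  have hge : ∀ x, H x ≠ 0 := by
    intro x hx
    have := hlo 0 x
    rw [zero_add, zero_sub, hev, ← sq, hx] at this
    simp [h0, eexp_ne_zero] at this
  have hm0 : (∫⁻ x, H x) ≠ 0 := by
    intro h
    rw [lintegral_eq_zero_iff hm] at h
    obtain ⟨y, hy⟩ := h.exists
    exact hge y hy
  have hmt : (∫⁻ x, H x) ≠ ⊤ := by
    refine ne_top_of_le_ne_top ?_ (lintegral_mono hle)
    rw [lintegral_const_mul' _ _ ht]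
    exact ENNReal.mul_ne_top ht (gauss_fin _ (by positivity))
  refine ⟨hm0, hmt, by fun_prop, ?_, ?_, ?_, ?_⟩
  · intro x z
    exact le_of_eq_of_le (by ring) ((mul_le_mul' (le_refl ((∫⁻ x, H x)⁻¹ ^ 2)) (hup x z)).trans_eq
      (by ring))
  · intro x z
    exact le_of_eq_of_le (by ring) ((mul_le_mul' (le_refl ((∫⁻ x, H x)⁻¹ ^ 2)) (hlo x z)).trans_eq
      (by ring))
  · rw [lintegral_const_mul _ hm, ENNReal.inv_mul_cancel hm0 hmt]
  · have h := integral_neg_eq_self (fun x => ((∫⁻ x, H x)⁻¹ * H x).toReal • x) volume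
    simp_rw [hev, smul_neg] at h
    rw [integral_neg] at h
    ext i
    have h3 := congrArg (fun w : Euc n => w i) h
    simp only [PiLp.neg_apply] at h3
    simp only [PiLp.zero_apply]
    linarith

theorem LpT_smul {p : ℝ} (hp : 0 < p) {k : ℝ≥0∞} (hk : k ≠ ⊤) (ρ : Euc n → ℝ≥0∞) (y : Euc n) :
    LpT p (fun x => k * ρ x) y = k ^ (p + 1) * LpT p ρ y := by
  unfold LpT
  rw [← lintegral_const_mul' _ _ (ENNReal.rpow_ne_top_of_nonneg (by linarith) hk)]
  apply lintegral_congr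
  intro x
  rw [ENNReal.mul_rpow_of_nonneg _ _ (by linarith)]
  ring

theorem JT_smul {p : ℝ} (hp : 0 < p) {k : ℝ≥0∞} (hk0 : k ≠ 0) (hk : k ≠ ⊤) (ρ : Euc n → ℝ≥0∞) :
    JT p (fun x => k * ρ x) = k ^ (-((p + 1) / p)) * JT p ρ := by
  unfold JT
  have hk' : k ^ (-((p + 1) / p)) ≠ ⊤ := by
    rw [ENNReal.rpow_neg]
    exact ENNReal.inv_ne_top.2 (by simp [hk0, hk])
  rw [← lintegral_const_mul' _ _ hk']
  apply lintegral_congr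
  intro y
  rw [LpT_smul hp hk, ENNReal.rpow_neg, ENNReal.mul_rpow_of_nonneg _ _ (by positivity),
    ENNReal.mul_inv, ← ENNReal.rpow_neg, ← ENNReal.rpow_neg, ← ENNReal.rpow_mul]
  · congr 2; field_simp
  · left; simp [hk0, hk]
  · left
    exact ENNReal.rpow_ne_top_of_nonneg (by positivity)
      (ENNReal.rpow_ne_top_of_nonneg (by linarith) hk)

/-- tilted marginal -/
def margH (p : ℝ) (ρ : Euc n → ℝ≥0∞) (η v : Euc n) : ℝ≥0∞ :=
  (∫⁻ u, eexp (p * ⟪u, η⟫) * rotR ρ u v ^ (p + 1)) ^ (1 / (p + 1))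

theorem margK_meas (p : ℝ) {ρ : Euc n → ℝ≥0∞} (hρ : Measurable ρ) (η : Euc n) :
    Measurable (Function.uncurry fun u v => eexp (p * ⟪u, η⟫) * rotR ρ u v ^ (p + 1)) := by
  have := rotR_meas hρ
  unfold Function.uncurry at *
  fun_prop

theorem margH_pow {p : ℝ} (hp : 0 < p) (ρ : Euc n → ℝ≥0∞) (η v : Euc n) :
    margH p ρ η v ^ (p + 1) = ∫⁻ u, eexp (p * ⟪u, η⟫) * rotR ρ u v ^ (p + 1) := by
  unfold margH
  rw [← ENNReal.rpow_mul, one_div, inv_mul_cancel₀ (by linarith), ENNReal.rpow_one]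

set_option maxHeartbeats 800000 in
theorem margH_cls {A B p : ℝ} (hA : 0 < A) (hB : 0 < B) (hp : 0 < p) {ρ : Euc n → ℝ≥0∞}
    (hρ : Cls A B ρ) (η : Euc n) :
    (∫⁻ x, margH p ρ η x) ≠ 0 ∧ (∫⁻ x, margH p ρ η x) ≠ ⊤ ∧
      Cls A B (fun x => (∫⁻ x, margH p ρ η x)⁻¹ * margH p ρ η x) := by
  have hp1 : 0 < p + 1 := by linarith
  have hm := hρ.meas
  have hK := margK_meas p hm η
  obtain ⟨a, b, c, d, ha, hb, hG⟩ := cls_bounds n hA hB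
  have hev : ∀ v, margH p ρ η (-v) = margH p ρ η v := by
    intro v
    unfold margH rotR
    congr 1
    apply lintegral_congr
    intro u
    rw [← sub_eq_add_neg, sub_neg_eq_add, mul_comm (ρ ((√2)⁻¹ • (u - v)))]
  have hz : (∫⁻ u, eexp (p * ⟪u, η⟫) * rotR ρ u 0 ^ (p + 1)) ≠ 0 := by
    intro h
    have hmm : Measurable (fun u => eexp (p * ⟪u, η⟫) * rotR ρ u 0 ^ (p + 1)) := by
      unfold rotR; fun_prop
    rw [lintegral_eq_zero_iff hmm] at h
    obtain ⟨u, hu⟩ := h.exists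
    have h1 : rotR ρ u 0 ≠ 0 := by
      have h2 : ∀ x, ρ x ≠ 0 := fun x => (lt_of_lt_of_le (eexp_pos _) (hG ρ hρ x).1).ne'
      unfold rotR
      exact mul_ne_zero (h2 _) (h2 _)
    simp [eexp_ne_zero, ENNReal.rpow_eq_zero_iff, h1] at hu
    linarith
  have ht : (∫⁻ u, eexp (p * ⟪u, η⟫) * rotR ρ u 0 ^ (p + 1)) ≠ ⊤ := by
    have : (∫⁻ u, eexp (p * ⟪u, η⟫) * rotR ρ u 0 ^ (p + 1)) ≤
        ∫⁻ u, eexp (p * ⟪u, η⟫ + (2 * d * (p + 1) - a * (p + 1) * ‖u‖ ^ 2)) := by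
      apply lintegral_mono
      intro u
      beta_reduce
      rw [eexp_add]
      gcongr
      have h1 := (hG ρ hρ ((√2)⁻¹ • u)).2
      have h2 : rotR ρ u 0 ≤ eexp (2 * d - a * ‖u‖ ^ 2) := by
        unfold rotR
        rw [add_zero, sub_zero]
        refine (mul_le_mul' h1 h1).trans_eq ?_
        rw [← eexp_add]
        congr 1
        rw [norm_smul, mul_pow, Real.norm_eq_abs, sq_abs, sq (√2)⁻¹, inv_sqrt_two_sq]
        ring
      refine (ENNReal.rpow_le_rpow h2 hp1.le).trans_eq ?_
      rw [eexp_rpow]; congr 1; ring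
    refine ne_top_of_le_ne_top ?_ this
    rw [gauss_lint' _ _ _ (by positivity)]
    exact ENNReal.mul_ne_top (eexp_ne_top _)
        (ENNReal.mul_ne_top ENNReal.ofReal_ne_top (eexp_ne_top _))
  refine cls_of_even hA ?_ ?_ ?_ hev ?_ ?_
  · exact (Measurable.lintegral_prod_left' hK).pow_const _
  · intro x z
    have h := marg_up hK (A := A * (p + 1)) ?_ x z
    · have := rpow_up (q := 1 / (p + 1)) (by positivity) h
      refine this.trans_eq ?_
      unfold margH
      congr 2; field_simp
    · intro u v s z
      have h1 := rpow_up hp1.le (rotR_up hρ u v s z)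
      have h2 : eexp (p * ⟪u + s, η⟫) * eexp (p * ⟪u - s, η⟫) = eexp (p * ⟪u, η⟫) ^ 2 := by
        rw [eexp_sq, ← eexp_add, inner_add_left, inner_sub_left]
        congr 1; ring
      refine le_of_eq_of_le (mul_mul_mul_comm _ _ _ _) ?_
      rw [h2, mul_pow, mul_assoc (eexp _ ^ 2)]
      refine mul_le_mul' le_rfl ?_
      refine h1.trans ?_
      gcongr
      apply eexp_mono
      have : 0 ≤ A * (p + 1) * ‖s‖ ^ 2 := by positivity
      nlinarith
  · intro x z
    have h := marg_lo hK (B := B * (p + 1)) ?_ x z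
    · have := rpow_lo (q := 1 / (p + 1)) (by positivity) h
      refine le_of_eq_of_le ?_ this
      unfold margH
      congr 2; field_simp
    · intro u v z
      have h1 := rpow_lo hp1.le (rotR_lo hρ u v 0 z)
      rw [add_zero, sub_zero] at h1
      refine le_of_le_of_eq ?_ (mul_mul_mul_comm _ _ _ _)
      rw [← sq, mul_pow, mul_assoc (eexp _ ^ 2)]
      refine mul_le_mul' le_rfl ?_
      refine le_of_eq_of_le ?_ h1
      congr 2
      simp; ring
  · unfold margH
    simp only [ne_eq, ENNReal.rpow_eq_zero_iff, hz, ht, false_and, or_self, not_false_iff]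
  · unfold margH
    exact ENNReal.rpow_ne_top_of_nonneg (by positivity) ht

theorem LpT_prod {p : ℝ} (hp : 0 < p) {ρ : Euc n → ℝ≥0∞} (hm : Measurable ρ) (η ζ : Euc n) :
    LpT p ρ ((√2)⁻¹ • (η + ζ)) * LpT p ρ ((√2)⁻¹ • (η - ζ)) = LpT p (margH p ρ η) ζ := by
  set s := (√2)⁻¹ • (η + ζ) with hs
  set t := (√2)⁻¹ • (η - ζ) with ht
  have hM : ∀ s, Measurable (fun x => eexp (p * ⟪x, s⟫) * ρ x ^ (p + 1)) := by
    intro s; fun_prop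
  have h1 : LpT p ρ s * LpT p ρ t = ∫⁻ x, ∫⁻ y, (eexp (p * ⟪x, s⟫) * ρ x ^ (p + 1)) *
      (eexp (p * ⟪y, t⟫) * ρ y ^ (p + 1)) := by
    unfold LpT
    rw [lintegral_lintegral_mul (hM s).aemeasurable (hM t).aemeasurable]
  rw [h1, ← rot_lint (F := fun x y => (eexp (p * ⟪x, s⟫) * ρ x ^ (p + 1)) *
      (eexp (p * ⟪y, t⟫) * ρ y ^ (p + 1))) (by unfold Function.uncurry; fun_prop)]
  rw [lintegral_lintegral_swap]
  · unfold LpT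
    apply lintegral_congr
    intro v
    rw [margH_pow hp, ← lintegral_const_mul' _ _ (eexp_ne_top _)]
    apply lintegral_congr
    intro u
    unfold rotR
    refine (mul_mul_mul_comm _ _ _ _).trans ?_
    rw [← mul_assoc (eexp (p * ⟪v, ζ⟫)), ← eexp_add, ← eexp_add, ENNReal.mul_rpow_of_nonneg _ _ (by linarith)]
    congr 2
    rw [← mul_add, ← mul_add, rot_inner, add_comm]
  · apply Measurable.aemeasurable
    unfold Function.uncurry
    fun_prop

theorem margH_mink {A B p : ℝ} (hA : 0 < A) (hB : 0 < B) (hp : 0 < p) {ρ : Euc n → ℝ≥0∞}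
    (hρ : Cls A B ρ) (η : Euc n) :
    LpT p (conv2 ρ) η ^ (1 / (p + 1)) ≤ ∫⁻ v, margH p ρ η v := by
  have hp1 : 0 < p + 1 := by linarith
  have hm := hρ.meas
  have hR := rotR_meas hm
  have e1 : ∀ u, (∫⁻ v, eexp (p / (p + 1) * ⟪u, η⟫) * rotR ρ u v) ^ (p + 1) =
      eexp (p * ⟪u, η⟫) * conv2 ρ u ^ (p + 1) := by
    intro u
    rw [lintegral_const_mul' _ _ (eexp_ne_top _), ENNReal.mul_rpow_of_nonneg _ _ hp1.le, eexp_rpow]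
    congr 2
    field_simp
  have e2 : ∀ u v, (eexp (p / (p + 1) * ⟪u, η⟫) * rotR ρ u v) ^ (p + 1) =
      eexp (p * ⟪u, η⟫) * rotR ρ u v ^ (p + 1) := by
    intro u v
    rw [ENNReal.mul_rpow_of_nonneg _ _ hp1.le, eexp_rpow]
    congr 2
    field_simp
  have h := mink (K := fun u v => eexp (p / (p + 1) * ⟪u, η⟫) * rotR ρ u v) (q := p + 1) (by
    unfold Function.uncurry at *; fun_prop) (by linarith) (by
      simp_rw [e1]
      exact LpT_ne_top hA hB hp (cls_conv2 hA hB hρ) η)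
  simp_rw [e1, e2] at h
  exact h

theorem improve {A B p : ℝ} (hA : 0 < A) (hB : 0 < B) (hp : 0 < p) {ρ : Euc n → ℝ≥0∞}
    (hρ : Cls A B ρ) {S : ℝ≥0∞} (hSt : S ≠ ⊤)
    (hS : ∀ ρ' : Euc n → ℝ≥0∞, Cls A B ρ' → JT p ρ' ≤ S) :
    JT p ρ * JT p ρ ≤ S * JT p (conv2 ρ) := by
  have hm := hρ.meas
  have hLm := LpT_meas p hm
  have h1 : JT p ρ * JT p ρ = ∫⁻ x, ∫⁻ y, LpT p ρ x ^ (-(1 / p)) * LpT p ρ y ^ (-(1 / p)) := by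
    unfold JT
    rw [lintegral_lintegral_mul (hLm.pow_const _).aemeasurable (hLm.pow_const _).aemeasurable]
  rw [h1, ← rot_lint (F := fun x y => LpT p ρ x ^ (-(1 / p)) * LpT p ρ y ^ (-(1 / p))) (by
    unfold Function.uncurry; fun_prop)]
  have h2 : ∀ η ζ, LpT p ρ ((√2)⁻¹ • (η + ζ)) ^ (-(1 / p)) *
      LpT p ρ ((√2)⁻¹ • (η - ζ)) ^ (-(1 / p)) = LpT p (margH p ρ η) ζ ^ (-(1 / p)) := by
    intro η ζ
    rw [← LpT_prod hp hm, ENNReal.mul_rpow_of_ne_top (LpT_ne_top hA hB hp hρ _)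
      (LpT_ne_top hA hB hp hρ _)]
  simp_rw [h2]
  conv_rhs => unfold JT
  rw [← lintegral_const_mul' _ _ hSt]
  apply lintegral_mono
  intro η
  obtain ⟨m0, mt, hc⟩ := margH_cls hA hB hp hρ η
  change JT p (margH p ρ η) ≤ _
  set m := ∫⁻ x, margH p ρ η x with hmdef
  have e : margH p ρ η = fun x => m * (m⁻¹ * margH p ρ η x) := by
    ext1 x
    rw [← mul_assoc, ENNReal.mul_inv_cancel m0 mt, one_mul]
  rw [e, JT_smul hp m0 mt, mul_comm]
  refine mul_le_mul' (hS _ hc) ?_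
  have h3 := neg_rpow_anti (r := (p + 1) / p) (by positivity) (margH_mink hA hB hp hρ η)
  refine h3.trans_eq ?_
  rw [← ENNReal.rpow_mul]
  congr 1
  field_simp

theorem conv2_max {A B p : ℝ} (hA : 0 < A) (hB : 0 < B) (hp : 0 < p) {ρ : Euc n → ℝ≥0∞}
    (hρ : Cls A B ρ)
    (hS : ∀ ρ' : Euc n → ℝ≥0∞, Cls A B ρ' → JT p ρ' ≤ JT p ρ) :
    JT p (conv2 ρ) = JT p ρ := by
  have h0 := JT_ne_zero hA hB hp hρ
  obtain ⟨C, hC, hCb⟩ := JT_fin (n := n) hA hB hp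
  have ht : JT p ρ ≠ ⊤ := ne_top_of_le_ne_top hC (hCb _ hρ)
  apply le_antisymm (hS _ (cls_conv2 hA hB hρ))
  exact (ENNReal.mul_le_mul_iff_right h0 ht).1 (improve hA hB hp hρ ht hS)

end

section

variable {n : ℕ}

theorem pos_factor (T : Euc n →L[ℝ] Euc n) (hT : T.toLinearMap.IsPositive) :
    ∃ B : Euc n →ₗ[ℝ] Euc n, ∀ ξ, ‖B ξ‖ ^ 2 = ⟪T ξ, ξ⟫ := by
  have hs := hT.isSymmetric
  have hf : Module.finrank ℝ (Euc n) = n := finrank_euclideanSpace_fin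
  set b := hs.eigenvectorBasis hf with hb
  set l := hs.eigenvalues hf with hl
  have hl0 : ∀ i, 0 ≤ l i := fun i => hT.nonneg_eigenvalues hf i
  refine ⟨(WithLp.linearEquiv 2 ℝ (Fin n → ℝ)).symm.toLinearMap ∘ₗ
    LinearMap.pi (fun i => √(l i) • (innerSL ℝ (b i)).toLinearMap), ?_⟩
  intro ξ
  rw [EuclideanSpace.real_norm_sq_eq, ← OrthonormalBasis.sum_inner_mul_inner b]
  apply Finset.sum_congr rfl
  intro i _
  have h1 : ⟪T ξ, b i⟫ = l i * ⟪ξ, b i⟫ := by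
    have := hs ξ (b i)
    rw [hb, hs.apply_eigenvectorBasis hf i] at this
    simp only [ContinuousLinearMap.coe_coe] at this
    rw [hb, this, inner_smul_right]
    rfl
  rw [h1]
  change (√(l i) * ⟪b i, ξ⟫) ^ 2 = _
  rw [mul_pow, Real.sq_sqrt (hl0 i), real_inner_comm ξ (b i)]
  ring

theorem sq_le_exp_quad {a : ℝ} (ha : 0 < a) (t : ℝ) : t ^ 2 ≤ 1 / a * exp (a * t ^ 2) := by
  have := Real.add_one_le_exp (a * t ^ 2)
  rw [div_mul_eq_mul_div, one_mul, le_div_iff₀ ha]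
  linarith

theorem mu_memLp {A B : ℝ} (hA : 0 < A) (hB : 0 < B) {ρ : Euc n → ℝ≥0∞} (hρ : Cls A B ρ) :
    MemLp id 2 (mu ρ) := by
  obtain ⟨a, b, c, d, ha, hb, hG⟩ := cls_bounds n hA hB
  refine ⟨measurable_id.aestronglyMeasurable, ?_⟩
  rw [eLpNorm_lt_top_iff_lintegral_rpow_enorm_lt_top (by norm_num) (by norm_num)]
  unfold mu
  rw [lintegral_withDensity_eq_lintegral_mul _ hρ.meas (by fun_prop)]
  refine lt_of_le_of_lt (lintegral_mono (g := fun x => ENNReal.ofReal (1 / (a / 2)) *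
    eexp (d - a / 2 * ‖x‖ ^ 2)) ?_) ?_
  · intro x
    simp only [Pi.mul_apply, id, ENNReal.toReal_ofNat]
    have h1 : ‖x‖ₑ ^ (2 : ℝ) ≤ ENNReal.ofReal (1 / (a / 2)) * eexp (a / 2 * ‖x‖ ^ 2) := by
      unfold eexp
      rw [← ofReal_norm, ENNReal.ofReal_rpow_of_nonneg (norm_nonneg _) (by norm_num),
        ← ENNReal.ofReal_mul (by positivity), Real.rpow_ofNat]
      exact ENNReal.ofReal_le_ofReal (sq_le_exp_quad (by positivity) _)
    refine (mul_le_mul' (hG ρ hρ x).2 h1).trans_eq ?_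
    rw [mul_left_comm, ← eexp_add]
    congr 2; ring
  · rw [lintegral_const_mul' _ _ ENNReal.ofReal_ne_top]
    exact (ENNReal.mul_ne_top ENNReal.ofReal_ne_top (lint_exp_sub (by positivity))).lt_top

theorem cov_pos {A B : ℝ} (hA : 0 < A) (hB : 0 < B) {ρ : Euc n → ℝ≥0∞} (hρ : Cls A B ρ)
    {ξ : Euc n} (hξ : ξ ≠ 0) : 0 < ⟪ProbabilityTheory.covarianceOperator (mu ρ) ξ, ξ⟫ := by
  obtain ⟨a, b, c, d, ha, hb, hG⟩ := cls_bounds n hA hB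
  have hM := mu_memLp hA hB hρ
  rw [ProbabilityTheory.covarianceOperator_inner hM]
  have hnn : ∀ z : Euc n, 0 ≤ ⟪ξ, z⟫ * ⟪ξ, z⟫ := fun z => mul_self_nonneg _
  refine lt_of_le_of_ne (integral_nonneg hnn) (fun h => hξ ?_)
  have hi : Integrable (fun z => ⟪ξ, z⟫ * ⟪ξ, z⟫) (mu ρ) := by
    have : MemLp (fun z => ⟪ξ, z⟫) 2 (mu ρ) := hM.const_inner ξ
    exact this.integrable_mul this
  have h2 := (integral_eq_zero_iff_of_nonneg hnn hi).1 h.symm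
  unfold mu at h2
  rw [Filter.EventuallyEq, ae_withDensity_iff hρ.meas] at h2
  have h3 : (fun z : Euc n => ⟪ξ, z⟫) =ᵐ[volume] fun _ => 0 := by
    filter_upwards [h2] with z hz
    have := hz (lt_of_lt_of_le (eexp_pos _) (hG ρ hρ z).1).ne'
    simpa using this
  have h4 := (Continuous.ae_eq_iff_eq volume (by fun_prop) (by fun_prop)).1 h3
  have h5 := congrFun h4 ξ
  simpa using h5

theorem clt_aux {A B : ℝ} (hA : 0 < A) (hB : 0 < B) {ρ : Euc n → ℝ≥0∞} (hρ : Cls A B ρ)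
    (ξ : Euc n) :
    Tendsto (fun k : ℕ => charFun (mu ρ) (((√2)⁻¹ ^ k) • ξ) ^ (2 ^ k)) atTop
      (nhds (Complex.exp (-((⟪ProbabilityTheory.covarianceOperator (mu ρ) ξ, ξ⟫ / 2 : ℝ) : ℂ)))) := by
  have hpr := mu_prob hρ
  by_cases hξ : ξ = 0
  · subst hξ
    simp [charFun_zero]
  have hQ := cov_pos hA hB hρ hξ
  have hM := mu_memLp hA hB hρ
  set Q := ⟪ProbabilityTheory.covarianceOperator (mu ρ) ξ, ξ⟫ with hQd
  set s := √Q with hs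
  have hs0 : 0 < s := Real.sqrt_pos.2 hQ
  have hs2 : s ^ 2 = Q := Real.sq_sqrt hQ.le
  have hX : Measurable (fun x : Euc n => s⁻¹ * ⟪ξ, x⟫) := by fun_prop
  have h0 : ∫ x, s⁻¹ * ⟪ξ, x⟫ ∂(mu ρ) = 0 := by
    rw [integral_const_mul, integral_inner (cls_integrable hA hB hρ),
      mu_integral hρ.meas (cls_ne_top hA hB hρ), hρ.cent]
    simp
  have h1 : ∫ x, ((fun x : Euc n => s⁻¹ * ⟪ξ, x⟫) ^ 2) x ∂(mu ρ) = 1 := by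
    have : ∀ x : Euc n, ((fun x : Euc n => s⁻¹ * ⟪ξ, x⟫) ^ 2) x = (s ^ 2)⁻¹ * (⟪ξ, x⟫ * ⟪ξ, x⟫) := by
      intro x; simp; ring
    simp_rw [this]
    rw [integral_const_mul, ← ProbabilityTheory.covarianceOperator_inner hM, hs2, ← hQd]
    exact inv_mul_cancel₀ hQ.ne'
  have h := ProbabilityTheory.tendsto_charFun_inv_sqrt_mul_pow hX.aemeasurable h0 h1 s
  have h2 := h.comp (tendsto_pow_atTop_atTop_of_one_lt (r := 2) (by norm_num))
  have e : Complex.exp (-((Q / 2 : ℝ) : ℂ)) = Complex.exp (-(s : ℂ) ^ 2 / 2) := by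
    rw [← hs2]; push_cast; congr 1; ring
  rw [e]
  refine h2.congr ?_
  intro k
  simp only [Function.comp]
  congr 1
  rw [charFun_apply, charFun_apply, integral_map hX.aemeasurable (by fun_prop)]
  apply integral_congr_ae
  refine ae_of_all _ fun x => ?_
  simp only
  congr 3
  have e2 : √((2 ^ k : ℕ) : ℝ) = √2 ^ k := by
    push_cast
    rw [Real.sqrt_eq_iff_mul_self_eq (by positivity) (by positivity), ← mul_pow,
      Real.mul_self_sqrt (by norm_num)]
  rw [e2, inner_smul_right, real_inner_comm ξ x]
  simp
  field_simp

end

section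

variable {n : ℕ}

theorem charFun_mu {ρ : Euc n → ℝ≥0∞} (hm : Measurable ρ) (ht : ∀ x, ρ x ≠ ⊤) (ξ : Euc n) :
    charFun (mu ρ) ξ = ∫ x, (ρ x).toReal • Complex.exp (⟪x, ξ⟫ * Complex.I) := by
  rw [charFun_apply]
  unfold mu
  rw [integral_withDensity_eq_integral_toReal_smul hm (ae_of_all _ fun x => (ht x).lt_top)]

theorem charFun_tendsto {A B : ℝ} (hA : 0 < A) (hB : 0 < B) {ρ : ℕ → Euc n → ℝ≥0∞}
    {ρ' : Euc n → ℝ≥0∞} (hρ : ∀ k, Cls A B (ρ k)) (hρ' : Cls A B ρ')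
    (hlim : ∀ x, Tendsto (fun k => ρ k x) atTop (nhds (ρ' x))) (ξ : Euc n) :
    Tendsto (fun k => charFun (mu (ρ k)) ξ) atTop (nhds (charFun (mu ρ') ξ)) := by
  obtain ⟨a, b, c, d, ha, hb, hG⟩ := cls_bounds n hA hB
  rw [charFun_mu hρ'.meas (cls_ne_top hA hB hρ')]
  simp_rw [fun k => charFun_mu (hρ k).meas (cls_ne_top hA hB (hρ k)) ξ]
  apply tendsto_integral_of_dominated_convergence (fun x => (eexp (d - a * ‖x‖ ^ 2)).toReal)
  · intro k
    have := (hρ k).meas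
    exact Measurable.aestronglyMeasurable (by fun_prop)
  · exact integrable_toReal_of_lintegral_ne_top (by fun_prop) (lint_exp_sub ha)
  · intro k
    refine ae_of_all _ fun x => ?_
    rw [norm_smul, Complex.norm_exp_ofReal_mul_I, mul_one, Real.norm_eq_abs,
      abs_of_nonneg ENNReal.toReal_nonneg]
    exact ENNReal.toReal_mono (eexp_ne_top _) (hG _ (hρ k) x).2
  · refine ae_of_all _ fun x => ?_
    exact ((ENNReal.tendsto_toReal (cls_ne_top hA hB hρ' x)).comp (hlim x)).smul_const _

/-- standard Gaussian density -/
def stdG (x : Euc n) : ℝ≥0∞ := eexp (-((n : ℝ) / 2 * log (2 * π)) - 1 / 2 * ‖x‖ ^ 2)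

theorem stdG_meas : Measurable (stdG (n := n)) := by
  unfold stdG; fun_prop

theorem charFun_stdG (ξ : Euc n) : charFun (mu stdG) ξ = Complex.exp (-((‖ξ‖ ^ 2 / 2 : ℝ) : ℂ)) := by
  rw [charFun_mu stdG_meas (fun x => eexp_ne_top _)]
  have h := GaussianFourier.integral_cexp_neg_mul_sq_norm_add (V := Euc n) (b := 1 / 2) (by norm_num)
    Complex.I ξ
  have e : ∀ x : Euc n, (stdG x).toReal • Complex.exp (⟪x, ξ⟫ * Complex.I) =
      Complex.exp (-((n : ℝ) / 2 * log (2 * π) : ℝ)) *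
        Complex.exp (-(1 / 2) * ‖x‖ ^ 2 + Complex.I * ⟪ξ, x⟫) := by
    intro x
    unfold stdG eexp
    rw [ENNReal.toReal_ofReal (exp_pos _).le, Complex.real_smul, Complex.ofReal_exp,
      ← Complex.exp_add, ← Complex.exp_add, real_inner_comm]
    congr 1
    push_cast
    ring
  simp_rw [e]
  rw [integral_const_mul, h, finrank_euclideanSpace_fin]
  have h2 : ((π : ℂ) / (1 / 2)) ^ ((n : ℂ) / 2) = Complex.exp ((n : ℝ) / 2 * log (2 * π) : ℝ) := by
    have : ((π : ℂ) / (1 / 2)) = ((2 * π : ℝ) : ℂ) := by push_cast; ring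
    rw [this, Complex.cpow_def_of_ne_zero (by simp [Real.pi_ne_zero]),
      ← Complex.ofReal_log (by positivity)]
    congr 1
    push_cast; ring
  rw [h2, ← Complex.exp_add, ← Complex.exp_add]
  congr 1
  push_cast
  rw [Complex.I_sq]
  ring

theorem ofReal_rpow_eexp {x : ℝ} (hx : 0 < x) (r : ℝ) : ENNReal.ofReal (x ^ r) = eexp (r * log x) := by
  unfold eexp
  rw [Real.rpow_def_of_pos hx, mul_comm]

theorem LpT_stdG {p : ℝ} (hp : 0 < p) (y : Euc n) :
    LpT p stdG y = eexp (-((n : ℝ) / 2 * log (2 * π)) * (p + 1) + (n : ℝ) / 2 * log (2 * π / (p + 1))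
      + p ^ 2 / (2 * (p + 1)) * ‖y‖ ^ 2) := by
  unfold LpT
  have e : ∀ x : Euc n, eexp (p * ⟪x, y⟫) * stdG x ^ (p + 1) =
      eexp (p * ⟪x, y⟫ + (-((n : ℝ) / 2 * log (2 * π)) * (p + 1) - (p + 1) / 2 * ‖x‖ ^ 2)) := by
    intro x
    unfold stdG
    rw [eexp_rpow, ← eexp_add]
    congr 1; ring
  simp_rw [e]
  rw [gauss_lint' _ _ _ (by positivity), ofReal_rpow_eexp (by positivity), ← eexp_add, ← eexp_add]
  congr 1
  rw [show π / ((p + 1) / 2) = 2 * π / (p + 1) by field_simp,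
    show p ^ 2 / (4 * ((p + 1) / 2)) = p ^ 2 / (2 * (p + 1)) by field_simp; norm_num]
  ring

theorem JT_stdG {p : ℝ} (hp : 0 < p) :
    JT p (stdG (n := n)) =
      ENNReal.ofReal ((2 * π * Real.sqrt ((1 + p) ^ ((1 + p) / p) / p)) ^ n) := by
  unfold JT
  simp_rw [LpT_stdG hp, eexp_rpow]
  set K := (-((n : ℝ) / 2 * log (2 * π)) * (p + 1) + (n : ℝ) / 2 * log (2 * π / (p + 1))) with hK
  have e : ∀ y : Euc n, (K + p ^ 2 / (2 * (p + 1)) * ‖y‖ ^ 2) * -(1 / p) =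
      -(K / p) + -(p / (2 * (p + 1)) * ‖y‖ ^ 2) := by
    intro y; field_simp; ring
  simp_rw [e, eexp_add]
  rw [lintegral_const_mul' _ _ (eexp_ne_top _), gauss_base _ (by positivity),
    ofReal_rpow_eexp (by positivity), ← eexp_add, ← Real.rpow_natCast, ofReal_rpow_eexp (by positivity)]
  congr 1
  rw [Real.log_mul (by positivity) (by positivity), Real.log_sqrt (by positivity),
    show π / (p / (2 * (p + 1))) = (2 * π) * (1 + p) / p by field_simp; ring,
    Real.log_div (y := p) (by positivity) (by positivity),
    Real.log_div (x := (1 + p) ^ ((1 + p) / p)) (by positivity) (by positivity),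
    Real.log_rpow (by positivity),
    Real.log_mul (y := 1 + p) (by positivity) (by positivity), hK,
    Real.log_div (y := p + 1) (by positivity) (by positivity), add_comm p 1]
  field_simp
  ring

theorem LpT_lin (L : Euc n →ₗ[ℝ] Euc n) (hL : LinearMap.det L ≠ 0) {p : ℝ} (hp : 0 < p)
    {ρ : Euc n → ℝ≥0∞} (hm : Measurable ρ) (y : Euc n) :
    LpT p (fun x => ENNReal.ofReal |LinearMap.det L| * ρ (L x)) (LinearMap.adjoint L y) =
      ENNReal.ofReal |LinearMap.det L| ^ p * LpT p ρ y := by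
  have h0 : ENNReal.ofReal |LinearMap.det L| ≠ 0 := (ENNReal.ofReal_pos.2 (abs_pos.2 hL)).ne'
  rw [LpT_smul hp ENNReal.ofReal_ne_top]
  unfold LpT
  have e : ∀ x, eexp (p * ⟪x, LinearMap.adjoint L y⟫) * ρ (L x) ^ (p + 1) =
      (fun x => eexp (p * ⟪x, y⟫) * ρ x ^ (p + 1)) (L x) := by
    intro x
    simp only [LinearMap.adjoint_inner_right]
  simp_rw [e]
  rw [lint_lin L hL (f := fun x => eexp (p * ⟪x, y⟫) * ρ x ^ (p + 1)) (by fun_prop), ← mul_assoc]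
  congr 1
  rw [abs_inv, ENNReal.ofReal_inv_of_pos (abs_pos.2 hL), ENNReal.rpow_add _ _ h0
    ENNReal.ofReal_ne_top, ENNReal.rpow_one, mul_assoc,
    ENNReal.mul_inv_cancel h0 ENNReal.ofReal_ne_top, mul_one]

theorem det_adj (L : Euc n →ₗ[ℝ] Euc n) :
    LinearMap.det (LinearMap.adjoint L) = LinearMap.det L := by
  have b := stdOrthonormalBasis ℝ (Euc n)
  rw [← LinearMap.det_toMatrix b.toBasis, LinearMap.toMatrix_adjoint, Matrix.det_conjTranspose,
    LinearMap.det_toMatrix]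
  simp

theorem JT_lin (L : Euc n →ₗ[ℝ] Euc n) (hL : LinearMap.det L ≠ 0) {p : ℝ} (hp : 0 < p)
    {ρ : Euc n → ℝ≥0∞} (hm : Measurable ρ) :
    JT p (fun x => ENNReal.ofReal |LinearMap.det L| * ρ (L x)) = JT p ρ := by
  have hLa := det_adj L
  have h0 : ENNReal.ofReal |LinearMap.det L| ≠ 0 := (ENNReal.ofReal_pos.2 (abs_pos.2 hL)).ne'
  have hLc : Continuous L := LinearMap.continuous_of_finiteDimensional L
  have hm2 : Measurable (fun x => ENNReal.ofReal |LinearMap.det L| * ρ (L x)) :=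
    (hm.comp hLc.measurable).const_mul _
  have h := lint_lin (LinearMap.adjoint L) (by rwa [hLa]) ((LpT_meas p hm2).pow_const (-(1 / p)))
  rw [hLa] at h
  simp_rw [LpT_lin L hL hp hm] at h
  change _ = _ * JT p _ at h
  have hd : (ENNReal.ofReal |LinearMap.det L| ^ p) ^ (-(1 / p)) = (ENNReal.ofReal |LinearMap.det L|)⁻¹ := by
    rw [← ENNReal.rpow_mul, show p * -(1 / p) = -1 by field_simp, ENNReal.rpow_neg_one]
  have e : ∀ y, (ENNReal.ofReal |LinearMap.det L| ^ p * LpT p ρ y) ^ (-(1 / p)) =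
      (ENNReal.ofReal |LinearMap.det L|)⁻¹ * LpT p ρ y ^ (-(1 / p)) := by
    intro y
    rw [← hd, ENNReal.rpow_neg, ENNReal.mul_rpow_of_nonneg _ _ (by positivity),
      ENNReal.mul_inv, ← ENNReal.rpow_neg, ← ENNReal.rpow_neg]
    · left; simp [h0]
    · left
      exact ENNReal.rpow_ne_top_of_nonneg (by positivity)
        (ENNReal.rpow_ne_top_of_nonneg hp.le ENNReal.ofReal_ne_top)
  simp_rw [e] at h
  rw [lintegral_const_mul' _ _ (ENNReal.inv_ne_top.2 h0), abs_inv,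
    ENNReal.ofReal_inv_of_pos (abs_pos.2 hL)] at h
  exact (((ENNReal.mul_right_inj (ENNReal.inv_ne_zero.2 ENNReal.ofReal_ne_top)
    (ENNReal.inv_ne_top.2 h0)).1 h)).symm

theorem mu_lin (L : Euc n →ₗ[ℝ] Euc n) (hL : LinearMap.det L ≠ 0)
    {ρ : Euc n → ℝ≥0∞} (hm : Measurable ρ) :
    (mu (fun x => ENNReal.ofReal |LinearMap.det L| * ρ (L x))).map L = mu ρ := by
  have hLc : Continuous L := LinearMap.continuous_of_finiteDimensional L
  have hLm := hLc.measurable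
  have h0 : ENNReal.ofReal |LinearMap.det L| ≠ 0 := (ENNReal.ofReal_pos.2 (abs_pos.2 hL)).ne'
  apply Measure.ext_of_lintegral
  intro f hf
  rw [lintegral_map hf hLm]
  unfold mu
  have hm2 : Measurable (fun x => ENNReal.ofReal |LinearMap.det L| * ρ (L x)) :=
    (hm.comp hLm).const_mul _
  have hf2 : Measurable (fun x => f (L x)) := hf.comp hLm
  rw [lintegral_withDensity_eq_lintegral_mul _ hm2 hf2,
    lintegral_withDensity_eq_lintegral_mul _ hm hf]
  have e : ∀ x, ((fun x => ENNReal.ofReal |LinearMap.det L| * ρ (L x)) * fun x => f (L x)) x =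
      ENNReal.ofReal |LinearMap.det L| * ((ρ * f) (L x)) := by
    intro x; simp [mul_assoc]
  refine (lintegral_congr e).trans ?_
  rw [lintegral_const_mul' _ _ ENNReal.ofReal_ne_top, lint_lin L hL (hm.mul hf), ← mul_assoc, abs_inv,
    ENNReal.ofReal_inv_of_pos (abs_pos.2 hL), ENNReal.mul_inv_cancel h0 ENNReal.ofReal_ne_top, one_mul]

theorem JT_of_gauss {A B p : ℝ} (hA : 0 < A) (hB : 0 < B) (hp : 0 < p) {ρ : Euc n → ℝ≥0∞}
    (hρ : Cls A B ρ) (W : Euc n →ₗ[ℝ] Euc n) (hW : Function.Injective W)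
    (hc : ∀ ξ, charFun (mu ρ) ξ = Complex.exp (-((‖W ξ‖ ^ 2 / 2 : ℝ) : ℂ))) :
    JT p ρ = JT p (stdG (n := n)) := by
  have hm := hρ.meas
  have hsurj : Function.Surjective W := LinearMap.injective_iff_surjective.1 hW
  have hdW : LinearMap.det W ≠ 0 := by
    have h1 := LinearEquiv.isUnit_det' (LinearEquiv.ofBijective W ⟨hW, hsurj⟩)
    exact h1.ne_zero
  set L := LinearMap.adjoint W with hL
  have hd : LinearMap.det L ≠ 0 := by rwa [hL, det_adj]
  have hLc : Continuous L := LinearMap.continuous_of_finiteDimensional L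
  have hLm := hLc.measurable
  set ρ2 : Euc n → ℝ≥0∞ := fun x => ENNReal.ofReal |LinearMap.det L| * ρ (L x) with hρ2
  have hm2 : Measurable ρ2 := (hm.comp hLm).const_mul _
  have hmap : (mu ρ2).map L = mu ρ := mu_lin L hd hm
  have hmass : ∫⁻ x, ρ2 x = 1 := by
    have h1 := congrArg (fun ν => ν Set.univ) hmap
    simp only [Measure.map_apply hLm MeasurableSet.univ, Set.preimage_univ] at h1
    unfold mu at h1
    rw [withDensity_apply _ MeasurableSet.univ, withDensity_apply _ MeasurableSet.univ,
      Measure.restrict_univ, hρ.mass] at h1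
    exact h1
  haveI : IsFiniteMeasure (mu ρ2) := ⟨by
    rw [mu, withDensity_apply _ MeasurableSet.univ, Measure.restrict_univ, hmass]; simp⟩
  haveI : IsFiniteMeasure (mu (stdG (n := n))) := ⟨by
    rw [mu, withDensity_apply _ MeasurableSet.univ, Measure.restrict_univ]
    exact (lint_exp_sub (by norm_num)).lt_top⟩
  have hch : charFun (mu ρ2) = charFun (mu (stdG (n := n))) := by
    ext1 η
    obtain ⟨ξ, rfl⟩ := hsurj η
    rw [charFun_stdG, ← hc ξ, ← hmap, charFun_apply, charFun_apply,
      integral_map hLm.aemeasurable (by fun_prop)]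
    simp only [hL, LinearMap.adjoint_inner_left]
  have hmu := Measure.ext_of_charFun hch
  have hae : ρ2 =ᵐ[volume] stdG := (withDensity_eq_iff hm2.aemeasurable stdG_meas.aemeasurable
    (by rw [hmass]; simp)).1 hmu
  rw [← JT_lin L hd hp hm]
  change JT p ρ2 = _
  have hLp : LpT p ρ2 = LpT p stdG := by
    ext1 y
    unfold LpT
    apply lintegral_congr_ae
    filter_upwards [hae] with x hx
    rw [hx]
  unfold JT
  rw [hLp]

theorem JT_le {A B p : ℝ} (hA : 0 < A) (hB : 0 < B) (hp : 0 < p) {ρ₀ : Euc n → ℝ≥0∞}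
    (h₀ : Cls A B ρ₀) : JT p ρ₀ ≤
      ENNReal.ofReal ((2 * π * Real.sqrt ((1 + p) ^ ((1 + p) / p) / p)) ^ n) := by
  obtain ⟨ρ, hρ, hmax⟩ := exists_max hA hB hp h₀
  refine (hmax _ h₀).trans_eq ?_
  set R : ℕ → Euc n → ℝ≥0∞ := fun k => conv2^[k] ρ with hR
  have hRs : ∀ k, R (k + 1) = conv2 (R k) := fun k => Function.iterate_succ_apply' _ _ _
  have hRc : ∀ k, Cls A B (R k) ∧ JT p (R k) = JT p ρ := by
    intro k
    induction k with
    | zero => exact ⟨hρ, rfl⟩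
    | succ k ih =>
      rw [hRs]
      refine ⟨cls_conv2 hA hB ih.1, ?_⟩
      rw [← ih.2]
      refine conv2_max hA hB hp ih.1 ?_
      rw [ih.2]
      exact hmax
  have hRch : ∀ k ξ, charFun (mu (R k)) ξ = charFun (mu ρ) (((√2)⁻¹ ^ k) • ξ) ^ (2 ^ k) := by
    intro k
    induction k with
    | zero => intro ξ; simp [hR]
    | succ k ih =>
      intro ξ
      rw [hRs, charFun_conv2 (hRc k).1, ih, smul_smul, ← pow_succ, ← pow_mul, ← pow_succ]
  obtain ⟨σ, hσ, ρ', hρ', hlim⟩ := cls_compact hA hB (fun k => (hRc k).1)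
  have hJ : JT p ρ' = JT p ρ := by
    have := JT_tendsto hA hB hp (fun k => (hRc (σ k)).1) hlim
    simp_rw [fun k => (hRc (σ k)).2] at this
    exact (tendsto_nhds_unique this tendsto_const_nhds)
  obtain ⟨W, hW⟩ := pos_factor _ (ProbabilityTheory.isPositive_covarianceOperator (μ := mu ρ))
  have hinj : Function.Injective W := by
    rw [injective_iff_map_eq_zero]
    intro ξ h
    by_contra hξ
    have h1 := cov_pos hA hB hρ hξ
    rw [← hW, h] at h1
    simp at h1
  have hc : ∀ ξ, charFun (mu ρ') ξ = Complex.exp (-((‖W ξ‖ ^ 2 / 2 : ℝ) : ℂ)) := by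
    intro ξ
    have h1 := charFun_tendsto hA hB (fun k => (hRc (σ k)).1) hρ' hlim ξ
    have h2 := (clt_aux hA hB hρ ξ).comp hσ.tendsto_atTop
    rw [← hW] at h2
    refine tendsto_nhds_unique h1 (h2.congr fun k => ?_)
    rw [Function.comp, hRch]
  rw [← hJ, JT_of_gauss hA hB hp hρ' W hinj hc, JT_stdG hp]

end

section

variable {n : ℕ}

theorem LpT_trans {p : ℝ} (ρ : Euc n → ℝ≥0∞) (t y : Euc n) :
    LpT p (fun x => ρ (x + t)) y = eexp (-(p * ⟪t, y⟫)) * LpT p ρ y := by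
  unfold LpT
  rw [← lint_trans (fun x => eexp (p * ⟪x, y⟫) * ρ x ^ (p + 1)) t,
    ← lintegral_const_mul' _ _ (eexp_ne_top _)]
  apply lintegral_congr
  intro x
  rw [← mul_assoc, ← eexp_add, inner_add_left]
  congr 2; ring

theorem JT_trans {p : ℝ} (hp : 0 < p) (ρ : Euc n → ℝ≥0∞) (t : Euc n) :
    JT p (fun x => ρ (x + t)) = ∫⁻ y, LpT p ρ y ^ (-(1 / p)) * eexp ⟪t, y⟫ := by
  unfold JT
  apply lintegral_congr
  intro y
  rw [LpT_trans, ENNReal.rpow_neg, ENNReal.mul_rpow_of_nonneg _ _ (by positivity),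
      ENNReal.mul_inv, ← ENNReal.rpow_neg, ← ENNReal.rpow_neg, eexp_rpow, mul_comm]
  · congr 2; field_simp
  · left; rw [eexp_rpow]; exact eexp_ne_zero _
  · left; rw [eexp_rpow]; exact eexp_ne_top _

theorem cls_normalize {A B : ℝ} {h : Euc n → ℝ≥0∞} (hm : Measurable h) (h1 : ∫⁻ x, h x = 1)
    (hup : ∀ x z, h (x + z) * h (x - z) ≤ h x ^ 2 * eexp (-(A * ‖z‖ ^ 2)))
    (hlo : ∀ x z, h x ^ 2 * eexp (-(B * ‖z‖ ^ 2)) ≤ h (x + z) * h (x - z))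
    (hi : Integrable (fun x => (h x).toReal • x)) :
    Cls A B (fun x => h (x + ∫ x, (h x).toReal • x)) := by
  set t := ∫ x, (h x).toReal • x with ht
  refine ⟨by fun_prop, ?_, ?_, ?_, ?_⟩
  · intro x z
    rw [show x + z + t = (x + t) + z by abel, show x - z + t = (x + t) - z by abel]
    exact hup _ _
  · intro x z
    rw [show x + z + t = (x + t) + z by abel, show x - z + t = (x + t) - z by abel]
    exact hlo _ _
  · rw [lint_trans h t, h1]
  · have hi0 : Integrable (fun x => (h x).toReal) :=
      integrable_toReal_of_lintegral_ne_top hm.aemeasurable (by rw [h1]; simp)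
    have e := integral_add_right_eq_self (μ := (volume : Measure (Euc n)))
      (fun x => (h x).toReal • (x - t)) t
    simp only [add_sub_cancel_right] at e
    rw [e]
    simp_rw [smul_sub]
    rw [integral_sub hi (hi0.smul_const t), integral_smul_const, ← ht,
      integral_toReal hm.aemeasurable (ae_lt_top hm (by rw [h1]; simp)), h1]
    simp

/-- Gaussian mass -/
def kap (n : ℕ) (b : ℝ) : ℝ≥0∞ := ∫⁻ x : Euc n, eexp (-(b * ‖x‖ ^ 2))

def fK (p : ℝ) (σ : Euc n → ℝ≥0∞) (b : ℝ) (u v : Euc n) : ℝ≥0∞ :=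
  σ u ^ (p + 1) * eexp (-(b * ‖v - u‖ ^ 2))

def hb (p : ℝ) (σ : Euc n → ℝ≥0∞) (b : ℝ) (v : Euc n) : ℝ≥0∞ :=
  (∫⁻ u, fK p σ b u v) ^ (1 / (p + 1))

theorem fK_meas (p : ℝ) {σ : Euc n → ℝ≥0∞} (hm : Measurable σ) (b : ℝ) :
    Measurable (Function.uncurry (fK p σ b)) := by
  unfold fK Function.uncurry
  fun_prop

theorem hb_meas (p : ℝ) {σ : Euc n → ℝ≥0∞} (hm : Measurable σ) (b : ℝ) :
    Measurable (hb p σ b) :=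
  (Measurable.lintegral_prod_left' (fK_meas p hm b)).pow_const _

theorem para (x z : Euc n) : ‖x + z‖ ^ 2 + ‖x - z‖ ^ 2 = 2 * ‖x‖ ^ 2 + 2 * ‖z‖ ^ 2 := by
  have := parallelogram_law_with_norm ℝ x z
  nlinarith

theorem norm_le_two (x z : Euc n) : ‖x‖ ^ 2 ≤ 2 * ‖z‖ ^ 2 + 2 * ‖x - z‖ ^ 2 := by
  have := para (x - z) z
  rw [sub_add_cancel] at this
  nlinarith [sq_nonneg ‖x - z - z‖]

theorem fK_up {p ε b : ℝ} (hp : 0 < p) (hε : 0 < ε) (hb0 : 0 < b) {σ : Euc n → ℝ≥0∞}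
    (hup : ∀ x z, σ (x + z) * σ (x - z) ≤ σ x ^ 2 * eexp (-(ε * ‖z‖ ^ 2))) (u v s z : Euc n) :
    fK p σ b (u + s) (v + z) * fK p σ b (u - s) (v - z) ≤
      fK p σ b u v ^ 2 * eexp (-(min (ε * (p + 1)) (2 * b) / 2 * ‖z‖ ^ 2)) := by
  have h1 := rpow_up (q := p + 1) (by linarith) (hup u s)
  unfold fK
  refine le_of_eq_of_le (mul_mul_mul_comm _ _ _ _) ?_
  rw [← eexp_add, mul_pow, mul_assoc ((σ u ^ (p + 1)) ^ 2), eexp_sq, ← eexp_add]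
  refine (mul_le_mul' h1 le_rfl).trans ?_
  rw [mul_assoc ((σ u ^ (p + 1)) ^ 2), ← eexp_add]
  refine mul_le_mul' le_rfl (eexp_mono ?_)
  have h2 := para (v - u) (z - s)
  rw [show v - u + (z - s) = v + z - (u + s) by abel,
    show v - u - (z - s) = v - z - (u - s) by abel] at h2
  have h3 := norm_le_two z s
  have h4 : min (ε * (p + 1)) (2 * b) ≤ ε * (p + 1) := min_le_left _ _
  have h5 : min (ε * (p + 1)) (2 * b) ≤ 2 * b := min_le_right _ _
  have h6 : 0 < min (ε * (p + 1)) (2 * b) := lt_min (by positivity) (by positivity)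
  have h7 := mul_le_mul_of_nonneg_right h4 (sq_nonneg ‖s‖)
  have h8 := mul_le_mul_of_nonneg_right h5 (sq_nonneg ‖z - s‖)
  have h9 := mul_le_mul_of_nonneg_left h3 h6.le
  have h10 : b * ‖v + z - (u + s)‖ ^ 2 + b * ‖v - z - (u - s)‖ ^ 2 =
    2 * b * ‖v - u‖ ^ 2 + 2 * b * ‖z - s‖ ^ 2 := by rw [← mul_add, h2]; ring
  nlinarith

theorem fK_lo {p b : ℝ} {σ : Euc n → ℝ≥0∞} (u v z : Euc n) :
    fK p σ b u v ^ 2 * eexp (-(2 * b * ‖z‖ ^ 2)) ≤ fK p σ b u (v + z) * fK p σ b u (v - z) := by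
  unfold fK
  refine le_of_le_of_eq ?_ (mul_mul_mul_comm _ _ _ _)
  rw [← sq, mul_pow, mul_assoc ((σ u ^ (p + 1)) ^ 2), eexp_sq, ← eexp_add, ← eexp_add]
  refine mul_le_mul' le_rfl (eexp_mono ?_)
  have h2 := para (v - u) z
  rw [show v - u + z = v + z - u by abel, show v - u - z = v - z - u by abel] at h2
  have h10 : b * ‖v + z - u‖ ^ 2 + b * ‖v - z - u‖ ^ 2 =
    2 * b * ‖v - u‖ ^ 2 + 2 * b * ‖z‖ ^ 2 := by rw [← mul_add, h2]; ring
  nlinarith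

theorem hb_up {p ε b : ℝ} (hp : 0 < p) (hε : 0 < ε) (hb0 : 0 < b) {σ : Euc n → ℝ≥0∞}
    (hm : Measurable σ)
    (hup : ∀ x z, σ (x + z) * σ (x - z) ≤ σ x ^ 2 * eexp (-(ε * ‖z‖ ^ 2))) (x z : Euc n) :
    hb p σ b (x + z) * hb p σ b (x - z) ≤
      hb p σ b x ^ 2 * eexp (-(min (ε * (p + 1)) (2 * b) / 2 / (p + 1) * ‖z‖ ^ 2)) := by
  have h := marg_up (fK_meas p hm b) (fK_up hp hε hb0 hup) x z
  refine (rpow_up (q := 1 / (p + 1)) (by positivity) h).trans_eq ?_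
  unfold hb
  congr 2; ring

theorem hb_lo {p b : ℝ} (hp : 0 < p) {σ : Euc n → ℝ≥0∞} (hm : Measurable σ) (x z : Euc n) :
    hb p σ b x ^ 2 * eexp (-(2 * b / (p + 1) * ‖z‖ ^ 2)) ≤
      hb p σ b (x + z) * hb p σ b (x - z) := by
  have h := marg_lo (fK_meas p hm b) fK_lo x z
  refine le_of_eq_of_le ?_ (rpow_lo (q := 1 / (p + 1)) (by positivity) h)
  unfold hb
  congr 2; ring

theorem gauss_shift {b : ℝ} (hb0 : 0 < b) (p : ℝ) (u y : Euc n) :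
    ∫⁻ x, eexp (p * ⟪x, y⟫) * eexp (-(b * ‖x - u‖ ^ 2)) =
      kap n b * eexp (p ^ 2 / (4 * b) * ‖y‖ ^ 2) * eexp (p * ⟪u, y⟫) := by
  rw [← lint_trans (fun x => eexp (p * ⟪x, y⟫) * eexp (-(b * ‖x - u‖ ^ 2))) u]
  have e : ∀ x : Euc n, eexp (p * ⟪x + u, y⟫) * eexp (-(b * ‖x + u - u‖ ^ 2)) =
      eexp (p * ⟪x, y⟫ + (p * ⟪u, y⟫ - b * ‖x‖ ^ 2)) := by
    intro x
    rw [← eexp_add, add_sub_cancel_right, inner_add_left]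
    congr 1; ring
  simp_rw [e]
  rw [gauss_lint' _ _ _ hb0, kap, gauss_base _ hb0, mul_comm]

theorem LpT_hb {p b : ℝ} (hp : 0 < p) (hb0 : 0 < b) {σ : Euc n → ℝ≥0∞} (hm : Measurable σ)
    (y : Euc n) :
    LpT p (hb p σ b) y = kap n b * eexp (p ^ 2 / (4 * b) * ‖y‖ ^ 2) * LpT p σ y := by
  have hk : kap n b ≠ ⊤ := gauss_fin b hb0
  unfold LpT
  have e : ∀ x, eexp (p * ⟪x, y⟫) * hb p σ b x ^ (p + 1) =
      ∫⁻ u, eexp (p * ⟪x, y⟫) * fK p σ b u x := by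
    intro x
    unfold hb
    rw [← ENNReal.rpow_mul, one_div, inv_mul_cancel₀ (by linarith), ENNReal.rpow_one,
      lintegral_const_mul' _ _ (eexp_ne_top _)]
  simp_rw [e]
  have hmK := fK_meas p hm b
  rw [lintegral_lintegral_swap]
  · rw [← lintegral_const_mul' _ _ (ENNReal.mul_ne_top hk (eexp_ne_top _))]
    apply lintegral_congr
    intro u
    rw [← mul_assoc, ← gauss_shift hb0, ← lintegral_mul_const]
    · apply lintegral_congr
      intro x
      unfold fK
      ring
    · fun_prop
  · apply Measurable.aemeasurable
    unfold fK Function.uncurry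
    fun_prop

theorem hb_bound {p a b d : ℝ} (hp : 0 < p) (ha : 0 < a) (hab : 2 * a * (p + 1) ≤ b)
    {σ : Euc n → ℝ≥0∞} (hσ : ∀ x, σ x ≤ eexp (d - a * ‖x‖ ^ 2)) (v : Euc n) :
    hb p σ b v ≤ kap n b ^ (1 / (p + 1)) *
      (ENNReal.ofReal (2 ^ ((n : ℝ) / 2)) ^ (1 / (p + 1)) * eexp (d - a / 2 * ‖v‖ ^ 2)) := by
  have hp1 : 0 < p + 1 := by linarith
  have hb0 : 0 < b := lt_of_lt_of_le (by positivity) hab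
  have hq : (0 : ℝ) ≤ 1 / (p + 1) := by positivity
  have h1 : ∫⁻ u, fK p σ b u v ≤
      kap n b * (ENNReal.ofReal (2 ^ ((n : ℝ) / 2)) * eexp ((d - a / 2 * ‖v‖ ^ 2) * (p + 1))) := by
    have h2 : ∀ u, fK p σ b u v ≤
        eexp ((d - a / 2 * ‖v‖ ^ 2) * (p + 1)) * eexp (-(b / 2 * ‖v - u‖ ^ 2)) := by
      intro u
      unfold fK
      refine (mul_le_mul' (ENNReal.rpow_le_rpow (hσ u) hp1.le) le_rfl).trans ?_
      rw [eexp_rpow, ← eexp_add, ← eexp_add]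
      apply eexp_mono
      have h3 := norm_le_two v u
      have h4 := mul_le_mul_of_nonneg_left h3 (by positivity : 0 ≤ a * (p + 1) / 2)
      have h5 := mul_le_mul_of_nonneg_right hab (sq_nonneg ‖v - u‖)
      nlinarith
    refine (lintegral_mono (μ := volume) h2).trans_eq ?_
    rw [lintegral_const_mul' _ _ (eexp_ne_top _),
      lintegral_sub_left_eq_self (fun u => eexp (-(b / 2 * ‖u‖ ^ 2))) v, gauss_base _ (by positivity),
      kap, gauss_base _ hb0, show π / (b / 2) = π / b * 2 by field_simp,
      Real.mul_rpow (by positivity) (by norm_num), ENNReal.ofReal_mul (by positivity)]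
    ring
  unfold hb
  refine (ENNReal.rpow_le_rpow h1 hq).trans_eq ?_
  rw [ENNReal.mul_rpow_of_nonneg _ _ hq, ENNReal.mul_rpow_of_nonneg _ _ hq, eexp_rpow]
  congr 3
  field_simp

theorem hb_mass {p b : ℝ} (hp : 0 < p) (hb0 : 0 < b) {σ : Euc n → ℝ≥0∞} (hm : Measurable σ)
    (ht : ∫⁻ x, σ x ≠ ⊤) :
    kap n b ^ (1 / (p + 1)) * ∫⁻ x, σ x ≤ ∫⁻ x, hb p σ b x := by
  have hp1 : 0 < p + 1 := by linarith
  have hk : kap n b ≠ ⊤ := gauss_fin b hb0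
  have e1 : ∀ w : Euc n, (∫⁻ x, σ (x - w) * eexp (-(b / (p + 1) * ‖w‖ ^ 2))) ^ (p + 1) =
      (∫⁻ x, σ x) ^ (p + 1) * eexp (-(b * ‖w‖ ^ 2)) := by
    intro w
    rw [lintegral_mul_const' _ _ (eexp_ne_top _), lintegral_sub_right_eq_self σ w,
      ENNReal.mul_rpow_of_nonneg _ _ hp1.le, eexp_rpow]
    congr 2
    field_simp
  have e2 : ∀ x w : Euc n, (σ (x - w) * eexp (-(b / (p + 1) * ‖w‖ ^ 2))) ^ (p + 1) =
      σ (x - w) ^ (p + 1) * eexp (-(b * ‖w‖ ^ 2)) := by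
    intro x w
    rw [ENNReal.mul_rpow_of_nonneg _ _ hp1.le, eexp_rpow]
    congr 2
    field_simp
  have ht' : (∫⁻ x, σ x) ^ (p + 1) ≠ ⊤ := ENNReal.rpow_ne_top_of_nonneg hp1.le ht
  have h := mink (K := fun w x => σ (x - w) * eexp (-(b / (p + 1) * ‖w‖ ^ 2))) (q := p + 1) (by
    unfold Function.uncurry; fun_prop) (by linarith) (by
      simp_rw [e1]
      rw [lintegral_const_mul' _ _ ht']
      exact ENNReal.mul_ne_top ht' hk)
  simp_rw [e1, e2] at h
  rw [lintegral_const_mul' _ _ ht', ENNReal.mul_rpow_of_nonneg _ _ (by positivity),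
    ← ENNReal.rpow_mul, mul_one_div_cancel hp1.ne', ENNReal.rpow_one, mul_comm] at h
  refine le_of_le_of_eq h ?_
  apply lintegral_congr
  intro x
  unfold hb
  congr 1
  rw [← lintegral_sub_left_eq_self (fun w => fK p σ b w x) x]
  apply lintegral_congr
  intro w
  unfold fK
  rw [sub_sub_cancel]

end

section

variable {n : ℕ}


/-- The constant in the main theorem. -/
def CC (n : ℕ) (p : ℝ) : ℝ≥0∞ :=
  ENNReal.ofReal ((2 * π * Real.sqrt ((1 + p) ^ ((1 + p) / p) / p)) ^ n)

theorem strong_step {p ε a d : ℝ} (hp : 0 < p) (hε : 0 < ε) (ha : 0 < a) {σ : Euc n → ℝ≥0∞}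
    (hm : Measurable σ)
    (hup : ∀ x z, σ (x + z) * σ (x - z) ≤ σ x ^ 2 * eexp (-(ε * ‖z‖ ^ 2)))
    (hσ : ∀ x, σ x ≤ eexp (d - a * ‖x‖ ^ 2)) (h0 : ∫⁻ x, σ x ≠ 0) :
    ∃ D : ℝ≥0∞, D ≠ ⊤ ∧ ∀ b : ℝ, 2 * a * (p + 1) ≤ b → ∃ t : Euc n, ‖t‖ₑ ≤ D ∧
      ∫⁻ y, (∫⁻ x, σ x) ^ ((p + 1) / p) *
        (eexp (-(p / (4 * b) * ‖y‖ ^ 2)) * LpT p σ y ^ (-(1 / p))) * eexp ⟪t, y⟫ ≤ CC n p := by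
  have hp1 : 0 < p + 1 := by linarith
  have hT : ∫⁻ x, σ x ≠ ⊤ :=
    ne_top_of_le_ne_top (lint_exp_sub (d := d) ha) (lintegral_mono (μ := volume) hσ)
  set m := ∫⁻ x, σ x with hmdef
  set Q : ℝ≥0∞ := ENNReal.ofReal (2 ^ ((n : ℝ) / 2)) ^ (1 / (p + 1)) with hQ
  have hQt : Q ≠ ⊤ := ENNReal.rpow_ne_top_of_nonneg (by positivity) ENNReal.ofReal_ne_top
  set C : ℝ≥0∞ := m⁻¹ * (Q * eexp d) with hC
  have hCt : C ≠ ⊤ := ENNReal.mul_ne_top (ENNReal.inv_ne_top.2 h0)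
    (ENNReal.mul_ne_top hQt (eexp_ne_top _))
  refine ⟨C * ∫⁻ x : Euc n, ‖x‖ₑ * eexp (-(2 * (a / 4) * ‖x‖ ^ 2)),
    ENNReal.mul_ne_top hCt (lint_gauss_lin (by positivity)), ?_⟩
  intro b hab
  have hb0 : 0 < b := lt_of_lt_of_le (by positivity) hab
  have hk : kap n b ≠ ⊤ := gauss_fin b hb0
  have hk0 : kap n b ≠ 0 := gauss_ne_zero b hb0
  set κ := kap n b ^ (1 / (p + 1)) with hκ
  have hκt : κ ≠ ⊤ := ENNReal.rpow_ne_top_of_nonneg (by positivity) hk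
  have hκ0 : κ ≠ 0 := (ENNReal.rpow_pos (pos_iff_ne_zero.2 hk0) hk).ne'
  have hmass := hb_mass hp hb0 hm hT
  rw [← hmdef, ← hκ] at hmass
  set M := ∫⁻ x, hb p σ b x with hM
  have hM0 : M ≠ 0 := by
    intro h
    rw [h] at hmass
    exact mul_ne_zero hκ0 h0 (le_antisymm hmass zero_le)
  have hbd := hb_bound hp ha hab hσ
  have hMt : M ≠ ⊤ := by
    refine ne_top_of_le_ne_top ?_ (lintegral_mono (μ := volume) hbd)
    rw [lintegral_const_mul' _ _ hκt, lintegral_const_mul' _ _ hQt]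
    exact ENNReal.mul_ne_top hκt (ENNReal.mul_ne_top hQt (lint_exp_sub (by positivity)))
  have hMi : M⁻¹ ≤ κ⁻¹ * m⁻¹ := by
    rw [← ENNReal.mul_inv (Or.inl hκ0) (Or.inl hκt)]
    exact ENNReal.inv_le_inv.2 hmass
  set h' : Euc n → ℝ≥0∞ := fun x => M⁻¹ * hb p σ b x with hh'
  have hMit : M⁻¹ ≠ ⊤ := ENNReal.inv_ne_top.2 hM0
  have hmeas : Measurable h' := (hb_meas p hm b).const_mul _
  have h1 : ∫⁻ x, h' x = 1 := by
    rw [hh', lintegral_const_mul' _ _ hMit, ← hM, ENNReal.inv_mul_cancel hM0 hMt]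
  have hbound : ∀ x, h' x ≤ C * eexp (-(2 * (a / 4) * ‖x - 0‖ ^ 2)) := by
    intro x
    rw [hh', sub_zero]
    refine (mul_le_mul' hMi (hbd x)).trans_eq ?_
    rw [← hQ, ← hκ, hC, show d - a / 2 * ‖x‖ ^ 2 = d + -(2 * (a / 4) * ‖x‖ ^ 2) by ring, eexp_add]
    calc _ = (κ⁻¹ * κ) * (m⁻¹ * (Q * eexp d) * eexp (-(2 * (a / 4) * ‖x‖ ^ 2))) := by ring
      _ = _ := by rw [ENNReal.inv_mul_cancel hκ0 hκt, one_mul]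
  obtain ⟨hi, hn⟩ := bary_bound hmeas h1 hCt (by positivity : 0 < a / 4) 0 hbound
  rw [sub_zero] at hn
  have hcls : Cls (min (ε * (p + 1)) (2 * b) / 2 / (p + 1)) (2 * b / (p + 1))
      (fun x => h' (x + ∫ x, (h' x).toReal • x)) := by
    apply cls_normalize hmeas h1 _ _ hi
    · intro x z
      have h := hb_up hp hε hb0 hm hup x z
      calc _ = M⁻¹ ^ 2 * (hb p σ b (x + z) * hb p σ b (x - z)) := by rw [hh']; ring
        _ ≤ M⁻¹ ^ 2 * _ := mul_le_mul' le_rfl h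
        _ = _ := by rw [hh']; ring
    · intro x z
      have h := hb_lo (b := b) hp hm x z
      calc _ = M⁻¹ ^ 2 * _ := by rw [hh', mul_pow, mul_assoc]
        _ ≤ M⁻¹ ^ 2 * _ := mul_le_mul' le_rfl h
        _ = _ := by rw [hh']; ring
  refine ⟨_, hn, ?_⟩
  have hJ := JT_le (lt_of_lt_of_le (by
    have : 0 < min (ε * (p + 1)) (2 * b) := lt_min (by positivity) (by positivity)
    positivity) le_rfl) (by positivity) hp hcls
  refine le_trans ?_ hJ
  rw [JT_trans hp]
  refine lintegral_mono (μ := volume) ?_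
  intro y
  beta_reduce
  refine mul_le_mul' ?_ le_rfl
  set L := LpT p σ y with hL
  have hkk : κ⁻¹ ^ (p + 1) * kap n b = 1 := by
    rw [ENNReal.inv_rpow, hκ, ← ENNReal.rpow_mul, one_div_mul_cancel hp1.ne', ENNReal.rpow_one,
      ENNReal.inv_mul_cancel hk0 hk]
  have hle : LpT p h' y ≤ (m⁻¹) ^ (p + 1) * (eexp (p ^ 2 / (4 * b) * ‖y‖ ^ 2) * L) := by
    rw [hh', LpT_smul hp hMit, LpT_hb hp hb0 hm]
    refine (mul_le_mul' (ENNReal.rpow_le_rpow hMi hp1.le) le_rfl).trans_eq ?_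
    rw [ENNReal.mul_rpow_of_nonneg _ _ hp1.le]
    calc _ = (κ⁻¹ ^ (p + 1) * kap n b) * (m⁻¹ ^ (p + 1) *
          (eexp (p ^ 2 / (4 * b) * ‖y‖ ^ 2) * L)) := by ring
      _ = _ := by rw [hkk, one_mul]
  refine le_of_eq_of_le ?_ (neg_rpow_anti (by positivity : 0 ≤ 1 / p) hle)
  have hm1 : m⁻¹ ^ (p + 1) ≠ 0 :=
    (ENNReal.rpow_pos (pos_iff_ne_zero.2 (ENNReal.inv_ne_zero.2 hT)) (ENNReal.inv_ne_top.2 h0)).ne'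
  have hm2 : m⁻¹ ^ (p + 1) ≠ ⊤ := ENNReal.rpow_ne_top_of_nonneg hp1.le (ENNReal.inv_ne_top.2 h0)
  have hpp : (0 : ℝ) ≤ 1 / p := by positivity
  rw [ENNReal.rpow_neg (_ * _) (1 / p), ENNReal.mul_rpow_of_nonneg _ _ hpp, ENNReal.mul_inv,
    ENNReal.mul_rpow_of_nonneg _ _ hpp, ENNReal.mul_inv, ← ENNReal.rpow_neg L, eexp_rpow,
    ENNReal.inv_rpow, ENNReal.inv_rpow, inv_inv, ← ENNReal.rpow_mul]
  · congr 2
    · ring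
    · apply ENNReal.eq_inv_of_mul_eq_one_left
      rw [← eexp_add, ← eexp_zero]
      congr 1
      field_simp
      ring
  · left; rw [eexp_rpow]; exact eexp_ne_zero _
  · left; rw [eexp_rpow]; exact eexp_ne_top _
  · left
    exact (ENNReal.rpow_pos (pos_iff_ne_zero.2 hm1) hm2).ne'
  · left
    exact ENNReal.rpow_ne_top_of_nonneg hpp hm2

theorem strong {p ε a d : ℝ} (hp : 0 < p) (hε : 0 < ε) (ha : 0 < a) {σ : Euc n → ℝ≥0∞}
    (hm : Measurable σ)
    (hup : ∀ x z, σ (x + z) * σ (x - z) ≤ σ x ^ 2 * eexp (-(ε * ‖z‖ ^ 2)))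
    (hσ : ∀ x, σ x ≤ eexp (d - a * ‖x‖ ^ 2)) (h0 : ∫⁻ x, σ x ≠ 0) :
    ∃ t : Euc n, (∫⁻ x, σ x) ^ ((p + 1) / p) * JT p (fun x => σ (x + t)) ≤ CC n p := by
  obtain ⟨D, hD, H⟩ := strong_step hp hε ha hm hup hσ h0
  have hT : ∫⁻ x, σ x ≠ ⊤ :=
    ne_top_of_le_ne_top (lint_exp_sub (d := d) ha) (lintegral_mono (μ := volume) hσ)
  have hTp : (∫⁻ x, σ x) ^ ((p + 1) / p) ≠ ⊤ :=
    ENNReal.rpow_ne_top_of_nonneg (by positivity) hT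
  choose t ht hle using fun k : ℕ => H (2 * a * (p + 1) + k) (by linarith [k.cast_nonneg (α := ℝ)])
  have hbd : ∀ k, t k ∈ Metric.closedBall (0 : Euc n) D.toReal := by
    intro k
    have := ht k
    rw [← ofReal_norm, ENNReal.ofReal_le_iff_le_toReal hD] at this
    simpa using this
  obtain ⟨t₀, -, s, hs, hlim⟩ := tendsto_subseq_of_bounded Metric.isBounded_closedBall hbd
  refine ⟨t₀, ?_⟩
  rw [JT_trans hp, ← lintegral_const_mul' _ _ hTp]
  set m := (∫⁻ x, σ x) ^ ((p + 1) / p) with hmd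
  set F : ℕ → Euc n → ℝ≥0∞ := fun k y =>
    m * (eexp (-(p / (4 * (2 * a * (p + 1) + (s k : ℝ))) * ‖y‖ ^ 2)) * LpT p σ y ^ (-(1 / p))) *
      eexp ⟪t (s k), y⟫ with hF
  have hLm := LpT_meas p hm
  have hFm : ∀ k, Measurable (F k) := by
    intro k
    rw [hF]
    fun_prop
  have hpt : ∀ y, Tendsto (fun k => F k y) atTop
      (nhds (m * (LpT p σ y ^ (-(1 / p)) * eexp ⟪t₀, y⟫))) := by
    intro y
    have e : ∀ k, F k y = (m * LpT p σ y ^ (-(1 / p))) *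
        eexp (-(p / (4 * (2 * a * (p + 1) + (s k : ℝ))) * ‖y‖ ^ 2) + ⟪t (s k), y⟫) := by
      intro k
      rw [hF, eexp_add]; ring
    simp_rw [e]
    rw [← mul_assoc]
    refine ENNReal.Tendsto.const_mul ?_ (Or.inl (eexp_ne_zero _))
    refine (continuous_eexp.tendsto _).comp ?_
    have h1 : Tendsto (fun k => (4 * (2 * a * (p + 1) + (s k : ℝ)))) atTop atTop := by
      refine Tendsto.const_mul_atTop (by norm_num) ?_
      exact tendsto_atTop_add_const_left _ _
        (tendsto_natCast_atTop_atTop.comp hs.tendsto_atTop)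
    have h2 := ((h1.const_div_atTop p).mul_const (‖y‖ ^ 2)).neg
    have h3 : Tendsto (fun k => ⟪t (s k), y⟫) atTop (nhds ⟪t₀, y⟫) :=
      hlim.inner tendsto_const_nhds
    have h4 := h2.add h3
    simpa using h4
  calc _ = ∫⁻ y, liminf (fun k => F k y) atTop := by
        apply lintegral_congr
        intro y
        exact (hpt y).liminf_eq.symm
    _ ≤ liminf (fun k => ∫⁻ y, F k y) atTop := lintegral_liminf_le hFm
    _ ≤ CC n p := by
        refine liminf_le_of_le (by isBoundedDefault) ?_
        intro b hb
        obtain ⟨k, hk⟩ := hb.exists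
        exact hk.trans (hle (s k))

end

section

variable {n : ℕ}


theorem erealExp_coe (r : ℝ) : erealExp (r : EReal) = eexp r := by
  simp [erealExp, eexp]

theorem erealExp_bot : erealExp ⊥ = 0 := by simp [erealExp]

theorem erealExp_meas : Measurable erealExp := by
  unfold erealExp
  refine Measurable.ite (measurableSet_singleton _) measurable_const ?_
  refine Measurable.ite (measurableSet_singleton _) measurable_const ?_
  exact ENNReal.measurable_ofReal.comp (Real.measurable_exp.comp measurable_ereal_toReal)

def rho (f : Euc n → EReal) (x : Euc n) : ℝ≥0∞ := erealExp (-(f x))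

theorem rho_cases {f : Euc n → EReal} (hf : ∀ x, f x ≠ ⊥) (x : Euc n) :
    (f x = ⊤ ∧ rho f x = 0) ∨ ∃ r : ℝ, f x = (r : EReal) ∧ rho f x = eexp (-r) := by
  unfold rho
  induction h : f x with
  | bot => exact absurd h (hf x)
  | top => left; simp [erealExp_bot]
  | coe r =>
    right
    refine ⟨r, rfl, ?_⟩
    rw [← EReal.coe_neg, erealExp_coe]

theorem rho_mid {f : Euc n → EReal} (hf : ∀ x, f x ≠ ⊥) (hc : ConvexE f) (x z : Euc n) :
    rho f (x + z) * rho f (x - z) ≤ rho f x ^ 2 := by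
  rcases rho_cases hf (x + z) with ⟨-, h⟩ | ⟨r, hr, h⟩
  · rw [h]; simp
  rcases rho_cases hf (x - z) with ⟨-, h'⟩ | ⟨s, hs, h'⟩
  · rw [h']; simp
  have h1 := hc (x + z) (x - z) (1 / 2) (by norm_num) (by norm_num)
  have e : (1 - 1 / 2 : ℝ) • (x + z) + (1 / 2 : ℝ) • (x - z) = x := by
    rw [show (1 - 1 / 2 : ℝ) = 1 / 2 by norm_num, ← smul_add,
      show x + z + (x - z) = (2 : ℝ) • x by rw [two_smul]; abel, smul_smul]
    norm_num
  rw [e, hr, hs, ← EReal.coe_mul, ← EReal.coe_mul, ← EReal.coe_add] at h1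
  rcases rho_cases hf x with ⟨h2, -⟩ | ⟨q, hq, h2⟩
  · rw [h2] at h1
    exact absurd (lt_of_le_of_lt h1 (EReal.coe_lt_top _)) (lt_irrefl _)
  · rw [hq, EReal.coe_le_coe_iff] at h1
    rw [h, h', h2, ← eexp_add, eexp_sq]
    apply eexp_mono
    linarith

theorem lc_bdd {ρ : Euc n → ℝ≥0∞} (hm : Measurable ρ)
    (hmid : ∀ x z, ρ (x + z) * ρ (x - z) ≤ ρ x ^ 2) (h0 : ∫⁻ x, ρ x ≠ 0) (hT : ∫⁻ x, ρ x ≠ ⊤) :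
    ∃ c : ℝ, ∀ x, ρ x ≤ eexp c := by
  set I := ∫⁻ x, ρ x ^ (1 / 2 : ℝ) with hI
  have hI0 : I ≠ 0 := by
    intro h
    rw [hI, lintegral_eq_zero_iff (hm.pow_const _)] at h
    apply h0
    rw [lintegral_eq_zero_iff hm]
    filter_upwards [h] with x hx
    rcases ENNReal.rpow_eq_zero_iff.1 hx with hx | hx
    · exact hx.1
    · exact absurd hx.2 (by norm_num)
  set L : Euc n →ₗ[ℝ] Euc n := (1 / 2 : ℝ) • LinearMap.id with hL
  have hdet : LinearMap.det L ≠ 0 := by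
    rw [hL, LinearMap.det_smul, LinearMap.det_id]; positivity
  set W : ℝ≥0∞ := ENNReal.ofReal |(LinearMap.det L)⁻¹| * ∫⁻ x, ρ x with hW
  have hW0 : W ≠ 0 := mul_ne_zero (ENNReal.ofReal_pos.2 (by positivity)).ne' h0
  have hWt : W ≠ ⊤ := ENNReal.mul_ne_top ENNReal.ofReal_ne_top hT
  have key : ∀ s, ρ s ^ (1 / 2 : ℝ) * I ≤ W := by
    intro s
    have h1 := lint_lin L hdet (f := fun x => ρ (x + (1 / 2 : ℝ) • s)) (by fun_prop)
    rw [lint_trans ρ] at h1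
    rw [hW, ← h1, hI, ← lintegral_const_mul _ (hm.pow_const _)]
    refine lintegral_mono (μ := volume) ?_
    intro x
    beta_reduce
    have h2 := hmid ((1 / 2 : ℝ) • x + (1 / 2 : ℝ) • s) ((1 / 2 : ℝ) • s - (1 / 2 : ℝ) • x)
    rw [show (1 / 2 : ℝ) • x + (1 / 2 : ℝ) • s + ((1 / 2 : ℝ) • s - (1 / 2 : ℝ) • x) =
        (2 : ℝ) • (1 / 2 : ℝ) • s by rw [two_smul]; abel,
      show (1 / 2 : ℝ) • x + (1 / 2 : ℝ) • s - ((1 / 2 : ℝ) • s - (1 / 2 : ℝ) • x) =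
        (2 : ℝ) • (1 / 2 : ℝ) • x by rw [two_smul]; abel, smul_smul, smul_smul,
        show (2 * (1 / 2) : ℝ) = 1 by norm_num, one_smul, one_smul] at h2
    have h3 := ENNReal.rpow_le_rpow h2 (by norm_num : (0 : ℝ) ≤ 1 / 2)
    rw [ENNReal.mul_rpow_of_nonneg _ _ (by norm_num), ← ENNReal.rpow_natCast,
      ← ENNReal.rpow_mul] at h3
    simpa [hL] using h3
  obtain ⟨c, hc⟩ := exists_le_eexp (X := (W / I) ^ (2 : ℝ))
    (ENNReal.rpow_ne_top_of_nonneg (by norm_num) (ENNReal.div_ne_top hWt hI0))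
  refine ⟨c, fun s => le_trans ?_ hc⟩
  have h4 : ρ s ^ (1 / 2 : ℝ) ≤ W / I :=
    (ENNReal.le_div_iff_mul_le (Or.inl hI0) (Or.inr hWt)).2 (key s)
  have h5 := ENNReal.rpow_le_rpow h4 (by norm_num : (0 : ℝ) ≤ 2)
  rw [← ENNReal.rpow_mul] at h5
  simpa using h5

theorem JT_anti {p : ℝ} (hp : 0 < p) {ρ ρ' : Euc n → ℝ≥0∞} (h : ∀ x, ρ' x ≤ ρ x) :
    JT p ρ ≤ JT p ρ' := by
  unfold JT
  refine lintegral_mono (μ := volume) fun y => ?_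
  refine neg_rpow_anti (by positivity) ?_
  unfold LpT
  refine lintegral_mono (μ := volume) fun x => ?_
  exact mul_le_mul' le_rfl (ENNReal.rpow_le_rpow (h x) (by linarith))

theorem lc_main {p : ℝ} (hp : 0 < p) {ρ : Euc n → ℝ≥0∞} (hm : Measurable ρ)
    (hmid : ∀ x z, ρ (x + z) * ρ (x - z) ≤ ρ x ^ 2) (h0 : ∫⁻ x, ρ x ≠ 0) (hT : ∫⁻ x, ρ x ≠ ⊤) :
    (∫⁻ x, ρ x) ^ ((p + 1) / p) * ⨅ t : Euc n, JT p (fun x => ρ (x + t)) ≤ CC n p := by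
  obtain ⟨c, hc⟩ := lc_bdd hm hmid h0 hT
  set r : ℕ → Euc n → ℝ≥0∞ := fun k x => ρ x * eexp (-(1 / ((k : ℝ) + 1) * ‖x‖ ^ 2)) with hr
  have hrm : ∀ k, Measurable (r k) := by
    intro k; rw [hr]; fun_prop
  have hrle : ∀ k x, r k x ≤ ρ x := by
    intro k x
    have : eexp (-(1 / ((k : ℝ) + 1) * ‖x‖ ^ 2)) ≤ 1 := by
      rw [← eexp_zero]
      apply eexp_mono
      have : 0 ≤ 1 / ((k : ℝ) + 1) * ‖x‖ ^ 2 := by positivity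
      linarith
    calc r k x ≤ ρ x * 1 := mul_le_mul' le_rfl this
      _ = ρ x := mul_one _
  have hk : ∀ k, (∫⁻ x, r k x) ^ ((p + 1) / p) * ⨅ t : Euc n, JT p (fun x => ρ (x + t)) ≤
      CC n p := by
    intro k
    have hδ : 0 < 1 / ((k : ℝ) + 1) := by positivity
    set δ := 1 / ((k : ℝ) + 1) with hδd
    obtain ⟨t, ht⟩ := strong hp (ε := 2 * δ) (a := δ) (d := c) (by positivity) hδ (hrm k) (by
      intro x z
      rw [hr]
      beta_reduce
      refine le_of_eq_of_le (mul_mul_mul_comm _ _ _ _) ?_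
      rw [mul_pow, mul_assoc (ρ x ^ 2), eexp_sq, ← eexp_add, ← eexp_add]
      refine mul_le_mul' (hmid x z) (eexp_mono ?_)
      have := para x z
      rw [← hδd]
      nlinarith) (by
      intro x
      rw [hr, sub_eq_add_neg, eexp_add]
      exact mul_le_mul' (hc x) le_rfl) (by
      intro h
      rw [lintegral_eq_zero_iff (hrm k)] at h
      apply h0
      rw [lintegral_eq_zero_iff hm]
      filter_upwards [h] with x hx
      simpa [hr, eexp_ne_zero] using hx)
    refine le_trans (mul_le_mul' le_rfl ?_) ht
    exact (iInf_le _ t).trans (JT_anti hp fun x => hrle k (x + t))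
  have hlim : Tendsto (fun k => ∫⁻ x, r k x) atTop (nhds (∫⁻ x, ρ x)) := by
    refine tendsto_lintegral_of_dominated_convergence ρ hrm
      (fun k => ae_of_all _ (hrle k)) hT (ae_of_all _ fun x => ?_)
    have h1 : Tendsto (fun k : ℕ => -(1 / ((k : ℝ) + 1) * ‖x‖ ^ 2)) atTop (nhds 0) := by
      have := ((tendsto_one_div_add_atTop_nhds_zero_nat (𝕜 := ℝ)).mul_const (‖x‖ ^ 2)).neg
      simpa using this
    have h2 := (continuous_eexp.tendsto 0).comp h1
    rw [eexp_zero] at h2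
    have h3 := ENNReal.Tendsto.const_mul (a := ρ x) h2 (Or.inl one_ne_zero)
    rw [mul_one] at h3
    exact h3
  have hq := (ENNReal.continuous_rpow_const (y := (p + 1) / p)).tendsto _ |>.comp hlim
  have h5 := ENNReal.Tendsto.mul_const (b := ⨅ t : Euc n, JT p (fun x => ρ (x + t))) hq
    (Or.inl (ENNReal.rpow_pos (pos_iff_ne_zero.2 h0) hT).ne')
  exact le_of_tendsto' h5 hk

theorem MpE_eq {p : ℝ} (hp : 0 < p) {f : Euc n → EReal} (hf : ∀ x, f x ≠ ⊥)
    (hm : Measurable (rho f)) (h0 : ∫⁻ x, rho f x ≠ 0) (hT : ∫⁻ x, rho f x ≠ ⊤) :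
    MpE p f = (∫⁻ x, rho f x) ^ ((p + 1) / p) * JT p (rho f) := by
  have hp1 : 0 < p + 1 := by linarith
  have hV : VolE f = ∫⁻ x, rho f x := rfl
  have hL : ∀ y, LpIntE p f y = LpT p (rho f) y := by
    intro y
    unfold LpIntE LpT
    apply lintegral_congr
    intro x
    rcases rho_cases hf x with ⟨h, h'⟩ | ⟨r, h, h'⟩
    · rw [h, h', EReal.coe_mul_top_of_pos hp1, EReal.sub_top, erealExp_bot,
        ENNReal.zero_rpow_of_pos hp1, mul_zero]
    · rw [h, h', ← EReal.coe_mul, ← EReal.coe_sub, erealExp_coe, eexp_rpow, ← eexp_add]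
      congr 1; ring
  have hLne : ∀ y, LpT p (rho f) y ≠ 0 := by
    intro y h
    unfold LpT at h
    rw [lintegral_eq_zero_iff (by fun_prop)] at h
    apply h0
    rw [lintegral_eq_zero_iff hm]
    filter_upwards [h] with x hx
    simpa [eexp_ne_zero, hp1, hp1.le, not_lt.2 hp1.le] using hx
  obtain ⟨v, hv⟩ := exists_eexp h0 hT
  have hS : ∀ y, erealExp (-(LpStar p f y)) =
      (∫⁻ x, rho f x) ^ (1 / p) * LpT p (rho f) y ^ (-(1 / p)) := by
    intro y
    unfold LpStar
    rw [hL]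
    split_ifs with h
    · rw [h, EReal.neg_top, erealExp_bot, ENNReal.top_rpow_of_neg (by
        have : 0 < 1 / p := by positivity
        linarith), mul_zero]
    · obtain ⟨l, hl⟩ := exists_eexp (hLne y) h
      rw [← EReal.coe_neg, erealExp_coe, Vol, hV, hv, hl, eexp_rpow, eexp_rpow, ← eexp_add]
      congr 1
      rw [eexp, eexp, ENNReal.toReal_ofReal (Real.exp_pos _).le,
        ENNReal.toReal_ofReal (Real.exp_pos _).le, ← Real.exp_sub, Real.log_exp]
      ring
  unfold MpE
  rw [hV, show VolE (LpStar p f) = ∫⁻ y, erealExp (-(LpStar p f y)) from rfl]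
  simp_rw [hS]
  rw [lintegral_const_mul' _ _ (ENNReal.rpow_ne_top_of_nonneg (by positivity) hT), ← mul_assoc]
  congr 1
  conv_lhs => rw [← ENNReal.rpow_one (∫⁻ x, rho f x)]
  rw [← ENNReal.rpow_mul, one_mul, ← ENNReal.rpow_add _ _ h0 hT]
  congr 1
  field_simp

end

/-- functional `L^p`-Santaló inequality for convex functions.
For `p ∈ (0,∞)`, `n ≥ 1`, and `φ ∈ Cvx(ℝⁿ)`, the infimum over translations of the
`L^p`-Mahler integral of `φ` is at most `(2π √((1+p)^((1+p)/p)/p))ⁿ = M_p(|x|²/2)`. -/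
theorem lp_santalo_cvx (n : ℕ) (hn : 1 ≤ n) (p : ℝ) (hp : 0 < p)
    (φ : Euc n → EReal) (hφ : InCvx φ) :
    ⨅ x : Euc n, MpE p (Transl x φ) ≤
      ENNReal.ofReal ((2 * π * Real.sqrt ((1 + p) ^ ((1 + p) / p) / p)) ^ n) := by
  have hm : Measurable (rho φ) :=
    erealExp_meas.comp (hφ.lsc.measurable.neg)
  have h0 : ∫⁻ x, rho φ x ≠ 0 := hφ.volPos.ne'
  have hT : ∫⁻ x, rho φ x ≠ ⊤ := hφ.volFin.ne
  have h := lc_main hp hm (rho_mid hφ.noBot hφ.convex) h0 hT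
  have e : ∀ t, MpE p (Transl t φ) =
      (∫⁻ x, rho φ x) ^ ((p + 1) / p) * JT p (fun x => rho φ (x + t)) := by
    intro t
    have e1 : rho (Transl t φ) = fun x => rho φ (x + t) := rfl
    have e2 : ∫⁻ x, rho (Transl t φ) x = ∫⁻ x, rho φ x := lint_trans (rho φ) t
    rw [MpE_eq (f := Transl t φ) hp (fun x => hφ.noBot _) (by rw [e1]; fun_prop) (by rw [e2]; exact h0)
      (by rw [e2]; exact hT), e2, e1]
  simp_rw [e]
  refine le_of_eq_of_le ?_ h
  rw [ENNReal.mul_iInf_of_ne (ENNReal.rpow_pos (pos_iff_ne_zero.2 h0) hT).ne'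
    (ENNReal.rpow_ne_top_of_nonneg (by positivity) hT)]

end
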